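/- Let p > 7 be a prime number and G = PSL(2, p). Then |Solv(G)| equals: (5p² + 5p + 4)/2 if p ≡ 1 (mod 24); 2p² + p + 2 if p ≡ 5 (mod 24); (5p² + p + 4)/2 if p ≡ 7 (mod 24); 2p² + 2 if p ≡ 11 (mod 24); 2p² + 2p + 2 if p ≡ 13 (mod 24); (5p² + 3p + 4)/2 if p ≡ 17 (mod 24); 2p² + p + 2 if p ≡ 19 (mod 24); and (5p² − p + 4)/2 if p ≡ 23 (mod 24). -/

import Mathlib

/-- The solvabilizer of an element `x` of a group `G`:
the set of `y ∈ G` such that `⟨x, y⟩` is solvable. -/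
def solvabilizer {G : Type*} [Group G] (x : G) : Set G :=
  {y | IsSolvable ↥(Subgroup.closure {x, y})}

/-- `Solv(G)`, the set of distinct solvabilizers of elements of `G`. -/
def solvSet (G : Type*) [Group G] : Set (Set G) :=
  Set.range fun x : G => solvabilizer x

/-- The projective special linear group `PSL(n, R)`. -/
noncomputable abbrev PSL (n : ℕ) (R : Type*) [CommRing R] : Type _ :=
  Matrix.SpecialLinearGroup (Fin n) R ⧸
    Subgroup.center (Matrix.SpecialLinearGroup (Fin n) R)

open Matrix

section PSLSolv
variable {F : Type*} [Field F]

local notation "M2" => Matrix (Fin 2) (Fin 2) F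

theorem m2_mul_apply (A B : M2) (i j : Fin 2) : (A * B) i j = A i 0 * B 0 j + A i 1 * B 1 j := by
  simp [Matrix.mul_apply, Fin.sum_univ_two]

/-- Commuting traceless matrices are parallel. -/
theorem parallel_of_commute (h2 : (2 : F) ≠ 0) (m z : M2) (hm : m ≠ 0) (tm : m.trace = 0)
    (tz : z.trace = 0) (h : m * z = z * m) : ∃ c : F, z = c • m := by
  have e00 := congrFun (congrFun h 0) 0
  have e01 := congrFun (congrFun h 0) 1
  have e10 := congrFun (congrFun h 1) 0
  simp only [m2_mul_apply] at e00 e01 e10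
  simp only [Matrix.trace_fin_two] at tm tz
  by_cases a : m 0 0 = 0
  · by_cases b : m 0 1 = 0
    · by_cases c : m 1 0 = 0
      · exact absurd (by ext i j; fin_cases i <;> fin_cases j <;> simp <;> grind) hm
      · refine ⟨z 1 0 / m 1 0, ?_⟩
        ext i j; fin_cases i <;> fin_cases j <;> simp <;> grind
    · refine ⟨z 0 1 / m 0 1, ?_⟩
      ext i j; fin_cases i <;> fin_cases j <;> simp <;> grind
  · refine ⟨z 0 0 / m 0 0, ?_⟩
    ext i j; fin_cases i <;> fin_cases j <;> simp <;> grind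

/-- (twice) the traceless part -/
def vpart (X : M2) : M2 := (2 : F) • X - X.trace • (1 : M2)

theorem vpart_trace (X : M2) : (vpart X).trace = 0 := by
  simp [vpart, Matrix.trace_fin_two]; ring

theorem vpart_commute (X w : M2) (h : X * w = w * X) : vpart X * w = w * vpart X := by
  simp [vpart, sub_mul, mul_sub, h]

theorem commute_of_vpart (h2 : (2 : F) ≠ 0) (X w : M2) (h : vpart X * w = w * vpart X) :
    X * w = w * X := by
  simp [vpart, sub_mul, mul_sub] at h
  exact smul_right_injective _ h2 h

theorem vpart_det (X : M2) (hX : X.det = 1) : (vpart X).det = 4 - X.trace ^ 2 := by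
  rw [Matrix.det_fin_two] at *
  simp [vpart, Matrix.trace_fin_two]
  linear_combination 4 * hX

theorem eq_of_vpart (h2 : (2 : F) ≠ 0) (X : M2) : X = (X.trace / 2) • (1 : M2) + (1/2 : F) • vpart X := by
  ext i j; fin_cases i <;> fin_cases j <;> simp [vpart, Matrix.trace_fin_two] <;> field_simp <;> ring

theorem trace_zero_of_anti (h2 : (2 : F) ≠ 0) (X w : M2) (hX : X.det ≠ 0) (h : X * w = - (w * X)) :
    w.trace = 0 := by
  have e00 := congrFun (congrFun h 0) 0
  have e01 := congrFun (congrFun h 0) 1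
  have e10 := congrFun (congrFun h 1) 0
  have e11 := congrFun (congrFun h 1) 1
  simp only [m2_mul_apply, Matrix.neg_apply] at e00 e01 e10 e11
  rw [Matrix.det_fin_two] at hX
  simp only [Matrix.trace_fin_two]
  have : 2 * (X 0 0 * X 1 1 - X 0 1 * X 1 0) * (w 0 0 + w 1 1) = 0 := by
    linear_combination X 1 1 * e00 + X 0 0 * e11 - X 0 1 * e10 - X 1 0 * e01
  grind

theorem det_comm (X Y : M2) (hX : X.det = 1) (hY : Y.det = 1) :
    (X * Y - Y * X).det = 4 - X.trace ^ 2 - Y.trace ^ 2 - (X * Y).trace ^ 2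
      + X.trace * Y.trace * (X * Y).trace := by
  rw [Matrix.det_fin_two] at *
  simp only [Matrix.trace_fin_two, m2_mul_apply, Matrix.sub_apply]
  grind

theorem det_comm_traceless (v w : M2) (hv : v.trace = 0) (hw : w.trace = 0) :
    (v * w - w * v).det = 4 * v.det * w.det - (v * w).trace ^ 2 := by
  simp only [Matrix.trace_fin_two, m2_mul_apply, Matrix.sub_apply, Matrix.det_fin_two] at *
  have h1 : v 1 1 = - v 0 0 := by linear_combination hv
  have h2 : w 1 1 = - w 0 0 := by linear_combination hw
  rw [h1, h2]; ring

theorem sq_traceless (v : M2) (hv : v.trace = 0) : v * v = (- v.det) • (1 : M2) := by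
  simp only [Matrix.trace_fin_two] at hv
  have h1 : v 1 1 = - v 0 0 := by linear_combination hv
  ext i j; fin_cases i <;> fin_cases j <;> simp [m2_mul_apply, Matrix.det_fin_two, h1] <;> ring

theorem anti_traceless (v w : M2) (hv : v.trace = 0) (hw : w.trace = 0) :
    v * w + w * v = (v * w).trace • (1 : M2) := by
  simp only [Matrix.trace_fin_two] at hv hw
  have h1 : v 1 1 = - v 0 0 := by linear_combination hv
  have h2 : w 1 1 = - w 0 0 := by linear_combination hw
  ext i j; fin_cases i <;> fin_cases j <;> simp [m2_mul_apply, Matrix.trace_fin_two, h1, h2] <;> ring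

theorem scalar_of_vpart_zero (h2 : (2 : F) ≠ 0) (X : M2) (h : vpart X = 0) :
    X = (X.trace / 2) • (1 : M2) := by
  conv_lhs => rw [eq_of_vpart h2 X, h]
  simp

/-- If two matrices normalize a traceless line, then the traces are special. -/
theorem special_of_normalize (h2 : (2 : F) ≠ 0) (X Y w : M2) (hX : X.det = 1) (hY : Y.det = 1)
    (hw0 : w ≠ 0) (hw : w.trace = 0) (c d : F) (hXw : X * w = c • (w * X))
    (hYw : Y * w = d • (w * Y)) :
    (X * Y - Y * X).det = 0 ∨ (X.trace = 0 ∧ Y.trace = 0) ∨ (X.trace = 0 ∧ (X * Y).trace = 0) ∨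
      (Y.trace = 0 ∧ (X * Y).trace = 0) := by
  by_cases hd : w.det = 0
  · left
    obtain ⟨e, he, hwe⟩ := Matrix.exists_mulVec_eq_zero_iff.mpr hd
    have ker : ∀ f : Fin 2 → F, w *ᵥ f = 0 → ∃ l : F, f = l • e := by
      intro f hf
      have a0 := congrFun hwe 0
      have a1 := congrFun hwe 1
      have b0 := congrFun hf 0
      have b1 := congrFun hf 1
      simp [Matrix.mulVec, dotProduct, Fin.sum_univ_two] at a0 a1 b0 b1
      have key : f 0 * e 1 = f 1 * e 0 := by
        by_contra hne
        apply hw0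
        have hne' : f 0 * e 1 - f 1 * e 0 ≠ 0 := sub_ne_zero.mpr hne
        ext i j
        fin_cases i <;> fin_cases j <;> simp <;> apply (mul_eq_zero.mp _).resolve_left hne'
        · linear_combination e 1 * b0 - f 1 * a0
        · linear_combination - e 0 * b0 + f 0 * a0
        · linear_combination e 1 * b1 - f 1 * a1
        · linear_combination - e 0 * b1 + f 0 * a1
      by_cases e0 : e 0 = 0
      · have e1 : e 1 ≠ 0 := fun e1 => he (by ext i; fin_cases i <;> simp [e0, e1])
        refine ⟨f 1 / e 1, ?_⟩
        ext i; fin_cases i <;> simp <;> grind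
      · refine ⟨f 0 / e 0, ?_⟩
        ext i; fin_cases i <;> simp <;> grind
    have eig : ∀ (X : M2) (c : F), X.det = 1 → X * w = c • (w * X) → ∃ l : F, X *ᵥ e = l • e := by
      intro X c hX h
      apply ker
      have hc : c ≠ 0 := by
        rintro rfl
        rw [zero_smul] at h
        apply hw0
        have hu : IsUnit X.det := by rw [hX]; exact isUnit_one
        calc w = X⁻¹ * (X * w) := by rw [Matrix.nonsing_inv_mul_cancel_left _ _ hu]
          _ = 0 := by rw [h, mul_zero]
      have : c • (w *ᵥ (X *ᵥ e)) = 0 := by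
        rw [Matrix.mulVec_mulVec, ← Matrix.smul_mulVec, ← h, ← Matrix.mulVec_mulVec, hwe,
          Matrix.mulVec_zero]
      exact (smul_eq_zero.mp this).resolve_left hc
    obtain ⟨l, hl⟩ := eig X c hX hXw
    obtain ⟨m, hm⟩ := eig Y d hY hYw
    apply Matrix.exists_mulVec_eq_zero_iff.mp
    refine ⟨e, he, ?_⟩
    rw [Matrix.sub_mulVec, ← Matrix.mulVec_mulVec, ← Matrix.mulVec_mulVec, hl, hm,
      Matrix.mulVec_smul, Matrix.mulVec_smul, hl, hm, smul_comm, sub_self]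
  · have sgn : ∀ (X : M2) (c : F), X.det = 1 → X * w = c • (w * X) → c = 1 ∨ c = -1 := by
      intro X c hX h
      have := congrArg Matrix.det h
      rw [Matrix.det_mul, Matrix.det_smul, Matrix.det_mul, hX] at this
      simp at this
      have : c ^ 2 = 1 := by
        have h3 : w.det * (c ^ 2 - 1) = 0 := by linear_combination - this
        have := (mul_eq_zero.mp h3).resolve_left hd
        linear_combination this
      exact sq_eq_one_iff.mp this
    have anti : ∀ Z : M2, Z * w = - (w * Z) → Z.trace = 0 := fun Z h =>
      trace_zero_of_anti h2 w Z hd (by rw [h, neg_neg])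
    rcases sgn X c hX hXw with rfl | rfl <;> rcases sgn Y d hY hYw with rfl | rfl <;>
      simp only [one_smul, neg_smul] at hXw hYw
    · left
      obtain ⟨a, ha⟩ := parallel_of_commute h2 w (vpart X) hw0 hw (vpart_trace X)
        (vpart_commute X w hXw).symm
      have : X * Y = Y * X := by
        apply commute_of_vpart h2
        rw [ha]; simp [hYw]
      rw [this]; simp
    · right; right; right
      refine ⟨anti _ hYw, anti _ ?_⟩
      rw [mul_assoc, hYw, mul_neg, ← mul_assoc, hXw, mul_assoc]
    · right; right; left
      refine ⟨anti _ hXw, anti _ ?_⟩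
      rw [mul_assoc, hYw, ← mul_assoc, hXw, neg_mul, mul_assoc]
    · right; left
      exact ⟨anti _ hXw, anti _ hYw⟩

end PSLSolv

open Matrix
set_option linter.unusedSimpArgs false
set_option linter.unusedVariables false
set_option linter.deprecated false

section PSLSolv
variable {F : Type*} [Field F]

local notation "M2" => Matrix (Fin 2) (Fin 2) F
local notation "SL" => Matrix.SpecialLinearGroup (Fin 2) F

theorem sl_mul_coe (A B : SL) : ((A * B : SL) : M2) = A.1 * B.1 := rfl

theorem sl_center_cases {A : SL} (h : A ∈ Subgroup.center SL) : A.1 = 1 ∨ A.1 = -1 := by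
  obtain ⟨r, hr, hA⟩ := Matrix.SpecialLinearGroup.mem_center_iff.mp h
  simp at hr
  rcases hr with rfl | rfl
  · left; rw [← hA]; simp
  · right; rw [← hA]; ext i j; fin_cases i <;> fin_cases j <;> simp

theorem sl_center_of_scalar (A : SL) (r : F) (h : A.1 = r • (1 : M2)) : A ∈ Subgroup.center SL := by
  apply Matrix.SpecialLinearGroup.mem_center_iff.mpr
  refine ⟨r, ?_, ?_⟩
  · have := A.2
    rw [h] at this
    simpa using this
  · rw [h]
    ext i j; fin_cases i <;> fin_cases j <;> simp

theorem sl_center_iff_vpart (h2 : (2 : F) ≠ 0) (A : SL) : A ∈ Subgroup.center SL ↔ vpart A.1 = 0 := by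
  constructor
  · intro h
    rcases sl_center_cases h with h | h <;> rw [h] <;> ext i j <;> fin_cases i <;> fin_cases j <;>
      simp [vpart, Matrix.trace_fin_two] <;> ring
  · intro h
    exact sl_center_of_scalar A _ (scalar_of_vpart_zero h2 _ h)

/-- A solvable noncentral subgroup has a noncentral normal subgroup that is abelian mod center. -/
theorem exists_normal_abelian_mod_center {G : Type*} [Group G] (H : Subgroup G)
    (hs : Group.IsSolvable H) (hc : ¬ H ≤ Subgroup.center G) :
    ∃ A : Subgroup G, (∀ h ∈ H, ∀ a ∈ A, h * a * h⁻¹ ∈ A) ∧ (∃ a ∈ A, a ∉ Subgroup.center G) ∧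
      ∀ a ∈ A, ∀ b ∈ A, a * b * a⁻¹ * b⁻¹ ∈ Subgroup.center G := by
  classical
  let D : ℕ → Subgroup G := fun n => (derivedSeries H n).map H.subtype
  have hex : ∃ n, D n ≤ Subgroup.center G := by
    obtain ⟨n, hn⟩ := hs.solvable
    exact ⟨n, by simp [D, hn]⟩
  have hfind := Nat.find_spec hex
  have hmin := fun m => Nat.find_min (H := hex) (m := m)
  generalize Nat.find hex = n at hfind hmin
  cases n with
  | zero =>
    exfalso; apply hc
    intro x hx
    exact hfind ⟨⟨x, hx⟩, by simp, rfl⟩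
  | succ n =>
    refine ⟨D n, ?_, ?_, ?_⟩
    · rintro h hh _ ⟨a, ha, rfl⟩
      refine ⟨⟨h, hh⟩ * a * ⟨h, hh⟩⁻¹, (derivedSeries_normal H n).conj_mem a ha _, by simp⟩
    · have := hmin n (Nat.lt_succ_self n)
      exact SetLike.not_le_iff_exists.mp this
    · rintro _ ⟨a, ha, rfl⟩ _ ⟨b, hb, rfl⟩
      apply hfind
      refine ⟨a * b * a⁻¹ * b⁻¹, ?_, by simp⟩
      rw [derivedSeries_succ]
      exact Subgroup.commutator_mem_commutator ha hb

theorem vpart_conj (X a : SL) : X.1 * vpart a.1 = vpart (X * a * X⁻¹ : SL).1 * X.1 := by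
  have h1 : ((X * a * X⁻¹ : SL) : M2) * X.1 = X.1 * a.1 := by
    rw [← sl_mul_coe, ← sl_mul_coe]; simp
  have h2 : (X * a * X⁻¹ : SL).1.trace = a.1.trace := by
    rw [sl_mul_coe, Matrix.trace_mul_comm, ← sl_mul_coe]; simp
  unfold vpart
  rw [sub_mul, mul_sub, h2, smul_mul_assoc, h1]
  simp

theorem eq_pm_of_commute (h2 : (2 : F) ≠ 0) (b w : M2) (hb : b.det = 1) (hw : w.det = 1)
    (tb : b.trace = 0) (tw : w.trace = 0) (h : b * w = w * b) : b = w ∨ b = - w := by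
  have hw0 : w ≠ 0 := by rintro rfl; simp at hw
  obtain ⟨c, hc⟩ := parallel_of_commute h2 w b hw0 tw tb h.symm
  rw [hc, Matrix.det_smul, hw] at hb
  simp at hb
  rcases hb with rfl | rfl
  · left; simpa using hc
  · right; simpa using hc

theorem scalar_of_commute_two (h2 : (2 : F) ≠ 0) (i j T : M2) (hi : i.det = 1) (hj : j.det = 1)
    (ti : i.trace = 0) (tj : j.trace = 0) (hij : i * j = - (j * i))
    (hTi : T * i = i * T) (hTj : T * j = j * T) : vpart T = 0 := by
  have hi0 : i ≠ 0 := by rintro rfl; simp at hi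
  obtain ⟨c, hc⟩ := parallel_of_commute h2 i _ hi0 ti (vpart_trace T) (vpart_commute T i hTi).symm
  have := vpart_commute T j hTj
  rw [hc, smul_mul_assoc, mul_smul_comm, hij, smul_neg] at this
  have h3 : (2 * c) • (j * i) = 0 := by
    rw [mul_smul, two_smul]
    nth_rewrite 1 [← this]; simp
  have hji : j * i ≠ 0 := by
    intro h
    have := congrArg Matrix.det h
    rw [Matrix.det_mul, hi, hj] at this; simp at this
  rcases smul_eq_zero.mp h3 with h | h
  · rcases mul_eq_zero.mp h with h | h
    · exact absurd h h2
    · rw [hc, h, zero_smul]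
  · exact absurd h hji

theorem quat_elements (h2 : (2 : F) ≠ 0) (i j b : M2) (hi : i.det = 1) (hj : j.det = 1)
    (ti : i.trace = 0) (tj : j.trace = 0) (hij : i * j = - (j * i)) (hb : b.det = 1)
    (hbi : b * i = i * b ∨ b * i = - (i * b)) (hbj : b * j = j * b ∨ b * j = - (j * b))
    (tb : b.trace = 0) :
    (b = i ∨ b = -i) ∨ (b = j ∨ b = -j) ∨ (b = i * j ∨ b = - (i * j)) := by
  have hk : (i * j).det = 1 := by rw [Matrix.det_mul, hi, hj, mul_one]
  have tk : (i * j).trace = 0 := by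
    have := congrArg Matrix.trace hij
    rw [Matrix.trace_neg, Matrix.trace_mul_comm j i] at this
    have : 2 * (i * j).trace = 0 := by linear_combination this
    exact (mul_eq_zero.mp this).resolve_left h2
  rcases hbi with hbi | hbi
  · exact Or.inl (eq_pm_of_commute h2 b i hb hi tb ti hbi)
  · rcases hbj with hbj | hbj
    · exact Or.inr (Or.inl (eq_pm_of_commute h2 b j hb hj tb tj hbj))
    · refine Or.inr (Or.inr (eq_pm_of_commute h2 b _ hb hk tb tk ?_))
      rw [← mul_assoc, hbi, neg_mul, mul_assoc, hbj, mul_neg, neg_neg, mul_assoc]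

theorem trace_of_quat_normalize (h2 : (2 : F) ≠ 0) (i j X i' j' : M2) (hi : i.det = 1)
    (hj : j.det = 1)
    (ti : i.trace = 0) (tj : j.trace = 0) (hij : i * j = - (j * i)) (hX : X.det = 1)
    (hXi : X * i = i' * X) (hXj : X * j = j' * X)
    (hi' : (i' = i ∨ i' = -i) ∨ (i' = j ∨ i' = -j) ∨ (i' = i * j ∨ i' = - (i * j)))
    (hj' : (j' = i ∨ j' = -i) ∨ (j' = j ∨ j' = -j) ∨ (j' = i * j ∨ j' = - (i * j))) :
    vpart X = 0 ∨ X.trace ^ 2 = 0 ∨ X.trace ^ 2 = 1 ∨ X.trace ^ 2 = 2 := by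
  have hii : i * i = -1 := by rw [sq_traceless i ti, hi]; simp
  have hjj : j * j = -1 := by rw [sq_traceless j tj, hj]; simp
  have tk : (i * j).trace = 0 := by
    have := congrArg Matrix.trace hij
    rw [Matrix.trace_neg, Matrix.trace_mul_comm j i] at this
    have : 2 * (i * j).trace = 0 := by linear_combination this
    exact (mul_eq_zero.mp this).resolve_left h2
  have hji : j * i = - (i * j) := by rw [hij, neg_neg]
  have hu : IsUnit X.det := by rw [hX]; exact isUnit_one
  have hij' : i' * j' = - (j' * i') := by
    have : (i' * j') * X = - (j' * i') * X := by
      rw [mul_assoc, ← hXj, ← mul_assoc, ← hXi, mul_assoc, hij, neg_mul, mul_assoc, ← hXi,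
        ← mul_assoc, ← hXj, mul_neg, mul_assoc]
    have := congrArg (· * X⁻¹) this
    simpa [Matrix.mul_nonsing_inv_cancel_right _ _ hu] using this
  set T : M2 := X - i * X * i - j * X * j - (i * j) * X * (i * j) with hT
  have r1 : ∀ Z : M2, i * (i * Z) = - Z := fun Z => by rw [← mul_assoc, hii]; simp
  have r2 : ∀ Z : M2, j * (j * Z) = - Z := fun Z => by rw [← mul_assoc, hjj]; simp
  have r3 : ∀ Z : M2, j * (i * Z) = - (i * (j * Z)) := fun Z => by
    rw [← mul_assoc, hji, neg_mul, mul_assoc]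
  have hTi : T * i = i * T := by
    simp only [hT, sub_mul, mul_sub, mul_assoc, r1, r2, r3, hji, hii, hjj, mul_neg, neg_mul, mul_one]
    abel
  have hTj : T * j = j * T := by
    simp only [hT, sub_mul, mul_sub, mul_assoc, r1, r2, r3, hji, hii, hjj, mul_neg, neg_mul, mul_one]
    abel
  have hvT := scalar_of_commute_two h2 i j T hi hj ti tj hij hTi hTj
  have hTs := scalar_of_vpart_zero h2 T hvT
  have tT : T.trace = 4 * X.trace := by
    have e1 : (i * X * i).trace = - X.trace := by
      rw [Matrix.trace_mul_comm, ← mul_assoc, hii]; simp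
    have e2 : (j * X * j).trace = - X.trace := by
      rw [Matrix.trace_mul_comm, ← mul_assoc, hjj]; simp
    have e3 : ((i * j) * X * (i * j)).trace = - X.trace := by
      rw [Matrix.trace_mul_comm, ← mul_assoc]
      simp [mul_assoc, r1, r2, r3]
    rw [hT, Matrix.trace_sub, Matrix.trace_sub, Matrix.trace_sub, e1, e2, e3]; ring
  have hTX : T = (1 - i * i' - j * j' - (i * j) * (i' * j')) * X := by
    rw [hT]
    simp only [sub_mul, one_mul, mul_assoc, hXi]
    rw [hXj]
    rw [← mul_assoc X i j, hXi, mul_assoc i' X j, hXj]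
  -- multiply by the adjugate
  have key : 4 * X.trace ^ 2 = 2 * (1 - i * i' - j * j' - (i * j) * (i' * j')).trace := by
    have h5 : T * X.adjugate = (1 - i * i' - j * j' - (i * j) * (i' * j')) := by
      rw [hTX, mul_assoc, Matrix.mul_adjugate, hX]; simp
    rw [← h5, hTs, tT]
    simp [Matrix.trace_fin_two, Matrix.adjugate_fin_two]
    field_simp
    ring
  have two : (1 : M2).trace = 2 := by simp
  have t1 : (i * (i * j)).trace = 0 := by rw [r1]; simp [tj]
  have fin : ∀ n : F, 4 * X.trace ^ 2 = 4 * n → X.trace ^ 2 = n := fun n h => by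
    have h4 : (2 * 2 : F) ≠ 0 := mul_ne_zero h2 h2
    apply mul_left_cancel₀ h4
    linear_combination h
  have nz : ∀ Z : M2, Z.det = 1 → Z = - Z → False := by
    intro Z hZ h
    have h3 : (2 : F) • Z = 0 := by rw [two_smul]; nth_rewrite 1 [h]; simp
    rcases smul_eq_zero.mp h3 with h | h
    · exact h2 h
    · rw [h] at hZ; simp at hZ
  have hk : (i * j).det = 1 := by rw [Matrix.det_mul, hi, hj, mul_one]
  rcases hi' with (rfl | rfl) | (rfl | rfl) | (rfl | rfl) <;>
    rcases hj' with (rfl | rfl) | (rfl | rfl) | (rfl | rfl)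
  all_goals first
    | (exfalso
       have h6 : (1 : M2) = -1 := by
         simpa [mul_assoc, r1, r2, r3, hii, hjj, hji, eq_comm] using hij'
       exact nz 1 Matrix.det_one h6)
    | (left; exact scalar_of_commute_two h2 _ _ X hi hj ti tj hij hXi hXj)
    | (right
       simp only [mul_assoc, r1, r2, r3, hii, hjj, hji, mul_neg, neg_mul, Matrix.trace_sub,
         Matrix.trace_add, two,
         Matrix.trace_neg, ti, tj, tk, neg_neg, t1, sub_neg_eq_add, mul_one] at key
       first
       | (left; apply fin; linear_combination key)
       | (right; left; apply fin; linear_combination key)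
       | (right; right; apply fin; linear_combination key))

theorem commute_cases {a b : SL} (h : a * b * a⁻¹ * b⁻¹ ∈ Subgroup.center SL) :
    a.1 * b.1 = b.1 * a.1 ∨ a.1 * b.1 = - (b.1 * a.1) := by
  have e : a.1 * b.1 = (a * b * a⁻¹ * b⁻¹ : SL).1 * (b.1 * a.1) := by
    have e' : a * b = (a * b * a⁻¹ * b⁻¹) * (b * a) := by simp [mul_assoc]
    exact congrArg Subtype.val e'
  rcases sl_center_cases h with h | h
  · left; rw [e, h, one_mul]
  · right; rw [e, h, neg_mul, one_mul]

/-- Necessary conditions for solvability, in terms of traces. -/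
theorem nec_of_solvable (h2 : (2 : F) ≠ 0) (X Y : SL)
    (hs : Group.IsSolvable (Subgroup.closure {X, Y})) :
    ((X.1 * Y.1 - Y.1 * X.1).det = 0 ∨ (X.1.trace = 0 ∧ Y.1.trace = 0) ∨
      (X.1.trace = 0 ∧ (X.1 * Y.1).trace = 0) ∨ (Y.1.trace = 0 ∧ (X.1 * Y.1).trace = 0)) ∨
    ((X.1.trace ^ 2 = 0 ∨ X.1.trace ^ 2 = 1 ∨ X.1.trace ^ 2 = 2) ∧
     (Y.1.trace ^ 2 = 0 ∨ Y.1.trace ^ 2 = 1 ∨ Y.1.trace ^ 2 = 2) ∧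
     ((X.1 * Y.1).trace ^ 2 = 0 ∨ (X.1 * Y.1).trace ^ 2 = 1 ∨ (X.1 * Y.1).trace ^ 2 = 2)) := by
  have hXm : X ∈ Subgroup.closure {X, Y} := Subgroup.subset_closure (by simp)
  have hYm : Y ∈ Subgroup.closure {X, Y} := Subgroup.subset_closure (by simp)
  by_cases hc : Subgroup.closure {X, Y} ≤ Subgroup.center SL
  · left; left
    have := Subgroup.mem_center_iff.mp (hc hXm) Y
    rw [← sl_mul_coe, ← sl_mul_coe, this]; simp
  obtain ⟨A, hA, ⟨i, hiA, hic⟩, hab⟩ := exists_normal_abelian_mod_center _ hs hc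
  -- if all conjugates commute with `a`, we are in the special case
  have main : ∀ a ∈ A, a ∉ Subgroup.center SL →
      (∀ b ∈ A, b.1 * a.1 = a.1 * b.1) →
      ((X.1 * Y.1 - Y.1 * X.1).det = 0 ∨ (X.1.trace = 0 ∧ Y.1.trace = 0) ∨
      (X.1.trace = 0 ∧ (X.1 * Y.1).trace = 0) ∨ (Y.1.trace = 0 ∧ (X.1 * Y.1).trace = 0)) := by
    intro a ha hac hcomm
    have ha0 : vpart a.1 ≠ 0 := fun h => hac ((sl_center_iff_vpart h2 a).mpr h)
    have norm : ∀ Z ∈ Subgroup.closure {X, Y}, ∃ c : F, Z.1 * vpart a.1 = c • (vpart a.1 * Z.1) := by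
      intro Z hZ
      have hb := hA Z hZ a ha
      have h3 := vpart_commute _ _ (hcomm _ hb)
      have h4 := vpart_commute _ _ h3.symm
      obtain ⟨c, hc⟩ := parallel_of_commute h2 _ _ ha0 (vpart_trace _) (vpart_trace _) h4
      refine ⟨c, ?_⟩
      rw [vpart_conj, hc, smul_mul_assoc]
    obtain ⟨c, hc⟩ := norm X hXm
    obtain ⟨d, hd⟩ := norm Y hYm
    exact special_of_normalize h2 X.1 Y.1 _ X.2 Y.2 ha0 (vpart_trace _) c d hc hd
  by_cases ht : i.1.trace = 0
  swap
  · left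
    refine main i hiA hic fun b hb => ?_
    rcases commute_cases (hab b hb i hiA) with h | h
    · exact h
    · exact absurd (trace_zero_of_anti h2 b.1 i.1 (by rw [b.2]; exact one_ne_zero) h) ht
  by_cases hall : ∀ b ∈ A, b.1 * i.1 = i.1 * b.1
  · left; exact main i hiA hic hall
  push Not at hall
  obtain ⟨j, hjA, hji⟩ := hall
  have hji' := (commute_cases (hab j hjA i hiA)).resolve_left hji
  have hij : i.1 * j.1 = - (j.1 * i.1) := by rw [hji', neg_neg]
  have tj : j.1.trace = 0 :=
    trace_zero_of_anti h2 i.1 j.1 (by rw [i.2]; exact one_ne_zero) hij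
  have elem : ∀ b ∈ A, b.1.trace = 0 → _ := fun b hb tb =>
    quat_elements h2 i.1 j.1 b.1 i.2 j.2 ht tj hij b.2 (commute_cases (hab b hb i hiA))
      (commute_cases (hab b hb j hjA)) tb
  have conjt : ∀ Z a : SL, (Z * a * Z⁻¹ : SL).1.trace = a.1.trace := by
    intro Z a
    rw [sl_mul_coe, Matrix.trace_mul_comm, ← sl_mul_coe]; simp
  have conjm : ∀ Z a : SL, Z.1 * a.1 = (Z * a * Z⁻¹ : SL).1 * Z.1 := by
    intro Z a
    rw [← sl_mul_coe, ← sl_mul_coe]; simp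
  have fin : ∀ Z ∈ Subgroup.closure {X, Y},
      vpart Z.1 = 0 ∨ Z.1.trace ^ 2 = 0 ∨ Z.1.trace ^ 2 = 1 ∨ Z.1.trace ^ 2 = 2 := by
    intro Z hZ
    exact trace_of_quat_normalize h2 i.1 j.1 Z.1 _ _ i.2 j.2 ht tj hij Z.2 (conjm Z i) (conjm Z j)
      (elem _ (hA Z hZ i hiA) (by rw [conjt, ht])) (elem _ (hA Z hZ j hjA) (by rw [conjt, tj]))
  rcases fin X hXm with h | hX
  · left; left
    rw [commute_of_vpart h2 X.1 Y.1 (by rw [h]; simp)]; simp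
  rcases fin Y hYm with h | hY
  · left; left
    rw [commute_of_vpart h2 Y.1 X.1 (by rw [h]; simp)]; simp
  rcases fin (X * Y) (mul_mem hXm hYm) with h | hXY
  · left; left
    have h3 := Subgroup.mem_center_iff.mp ((sl_center_iff_vpart h2 _).mpr h) X
    have h4 : X * Y = Y * X := by
      rw [mul_assoc] at h3
      exact mul_left_cancel h3
    rw [← sl_mul_coe, ← sl_mul_coe, h4]; simp
  · right; exact ⟨hX, hY, hXY⟩

end PSLSolv

open Matrix
set_option linter.unusedSimpArgs false
set_option linter.unusedVariables false
set_option linter.deprecated false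

section PSLSolv
variable {F : Type*} [Field F]

local notation "M2" => Matrix (Fin 2) (Fin 2) F
local notation "SL" => Matrix.SpecialLinearGroup (Fin 2) F

theorem solv_of_le {G : Type*} [Group G] (H K : Subgroup G) (h : H ≤ K) (hK : Group.IsSolvable K) :
    Group.IsSolvable H :=
  Group.isSolvable_of_isSolvable_injective (f := Subgroup.inclusion h)
    (Subgroup.inclusion_injective h)

theorem solv_of_rel {G P : Type*} [Group G] [Group P] (hP : Group.IsSolvable P)
    (R : Subgroup (G × P)) (K : Subgroup G) (hKs : Group.IsSolvable K)
    (hK : ∀ g, (g, 1) ∈ R → g ∈ K) (S : Set G) (hS : ∀ s ∈ S, ∃ p, (s, p) ∈ R) :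
    Group.IsSolvable (Subgroup.closure S) := by
  let g : R →* P := (MonoidHom.snd G P).comp R.subtype
  have hker : Group.IsSolvable g.ker := by
    let f : g.ker →* K :=
      { toFun := fun x => ⟨x.1.1.1, hK _ (by
          have h1 : x.1.1.2 = 1 := x.2
          have h2 := x.1.2
          rw [← h1]; exact h2)⟩
        map_one' := rfl
        map_mul' := fun _ _ => rfl }
    apply Group.isSolvable_of_isSolvable_injective (f := f)
    intro x y h
    have h1 : x.1.1.2 = 1 := x.2
    have h2 : y.1.1.2 = 1 := y.2
    have h3 : x.1.1.1 = y.1.1.1 := congrArg Subtype.val h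
    exact Subtype.ext (Subtype.ext (Prod.ext h3 (h1.trans h2.symm)))
  have hR : Group.IsSolvable R :=
    Group.isSolvable_of_ker_le_range g.ker.subtype g (by simp)
  have hmap : Group.IsSolvable (R.map (MonoidHom.fst G P)) :=
    Group.isSolvable_of_surjective (f := (MonoidHom.fst G P).subgroupMap R)
      ((MonoidHom.fst G P).subgroupMap_surjective R)
  refine solv_of_le _ _ ?_ hmap
  rw [Subgroup.closure_le]
  intro s hs
  obtain ⟨p, hp⟩ := hS s hs
  exact ⟨(s, p), hp, rfl⟩

theorem solv_of_metabelian {G : Type*} [Group G]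
    (h : ∀ a b c d : G, (a * b * a⁻¹ * b⁻¹) * (c * d * c⁻¹ * d⁻¹) =
      (c * d * c⁻¹ * d⁻¹) * (a * b * a⁻¹ * b⁻¹)) : Group.IsSolvable G := by
  have hc : Group.IsSolvable (commutator G) := by
    rw [commutator_eq_closure]
    have := Subgroup.isMulCommutative_closure (k := commutatorSet G) (by
      rintro _ ⟨a, b, rfl⟩ _ ⟨c, d, rfl⟩
      exact h a b c d)
    exact Group.isSolvable_of_comm fun a b => mul_comm' a b
  exact Group.isSolvable_of_ker_le_range (commutator G).subtype (Abelianization.of (G := G))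
    (by rw [Abelianization.ker_of]; simp)

theorem solv_perm3 : Group.IsSolvable (Equiv.Perm (Fin 3)) :=
  solv_of_metabelian (by decide +kernel)

theorem sl_inv_rel (Z : SL) (u v : M2) (h : Z.1 * u = v * Z.1) : (Z⁻¹ : SL).1 * v = u * (Z⁻¹ : SL).1 := by
  have h1 : (Z⁻¹ : SL).1 * Z.1 = 1 := by rw [← sl_mul_coe]; simp
  have h2 : Z.1 * (Z⁻¹ : SL).1 = 1 := by rw [← sl_mul_coe]; simp
  calc (Z⁻¹ : SL).1 * v = (Z⁻¹ : SL).1 * (v * Z.1) * (Z⁻¹ : SL).1 := by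
        rw [mul_assoc, mul_assoc, h2, mul_one]
    _ = u * (Z⁻¹ : SL).1 := by rw [← h, ← mul_assoc, h1, one_mul]

/-- the normalizer relation of a matrix -/
def normRel (w : M2) : Subgroup (SL × Fˣ) where
  carrier := {q | q.1.1 * w = (q.2 : F) • (w * q.1.1)}
  one_mem' := by simp
  mul_mem' := by
    rintro ⟨a, c⟩ ⟨b, d⟩ h1 h2
    simp only [Set.mem_setOf_eq, Prod.mk_mul_mk, sl_mul_coe, Units.val_mul] at *
    rw [mul_assoc, h2, mul_smul_comm, ← mul_assoc, h1, smul_mul_assoc, smul_smul, mul_assoc,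
      mul_comm (c : F)]
  inv_mem' := by
    rintro ⟨a, c⟩ h
    simp only [Set.mem_setOf_eq, Prod.inv_mk] at *
    have := sl_inv_rel a w ((c : F) • w) (by rw [h, smul_mul_assoc])
    rw [← this, mul_smul_comm, smul_smul]
    simp

/-- the centralizer of a matrix -/
def centSub (w : M2) : Subgroup SL where
  carrier := {q | q.1 * w = w * q.1}
  one_mem' := by simp
  mul_mem' := by
    rintro a b h1 h2
    simp only [Set.mem_setOf_eq, sl_mul_coe] at *
    rw [mul_assoc, h2, ← mul_assoc, h1, mul_assoc]
  inv_mem' := by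
    rintro a h
    exact sl_inv_rel a w w h

theorem centSub_solv (h2 : (2 : F) ≠ 0) (w : M2) (hw0 : w ≠ 0) (hw : w.trace = 0) :
    Group.IsSolvable (centSub w) := by
  apply Group.isSolvable_of_comm
  rintro ⟨a, ha⟩ ⟨b, hb⟩
  apply Subtype.ext
  apply Subtype.ext
  change a.1 * b.1 = b.1 * a.1
  obtain ⟨c, hc⟩ := parallel_of_commute h2 w _ hw0 hw (vpart_trace a.1) (vpart_commute _ _ ha).symm
  apply commute_of_vpart h2
  rw [hc, smul_mul_assoc, mul_smul_comm]
  congr 1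
  exact Eq.symm hb

theorem solv_of_normalize (h2 : (2 : F) ≠ 0) (S : Set SL) (w : M2) (hw0 : w ≠ 0) (hw : w.trace = 0)
    (hS : ∀ Z ∈ S, ∃ c : F, Z.1 * w = c • (w * Z.1)) : Group.IsSolvable (Subgroup.closure S) := by
  refine solv_of_rel inferInstance (normRel w) (centSub w) (centSub_solv h2 w hw0 hw) ?_ S ?_
  · intro g hg
    have : g.1 * w = ((1 : Fˣ) : F) • (w * g.1) := hg
    have h : g.1 * w = w * g.1 := by simpa using this
    exact h
  · intro s hs
    obtain ⟨c, hc⟩ := hS s hs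
    have hc0 : c ≠ 0 := by
      rintro rfl
      rw [zero_smul] at hc
      apply hw0
      have h1 : (s⁻¹ : SL).1 * s.1 = 1 := by rw [← sl_mul_coe]; simp
      calc w = (s⁻¹ : SL).1 * (s.1 * w) := by rw [← mul_assoc, h1, one_mul]
        _ = 0 := by rw [hc, mul_zero]
    exact ⟨Units.mk0 c hc0, hc⟩

/-- relation for the quaternion normalizer -/
def quatRel (f : Fin 3 → M2) : Subgroup (SL × Equiv.Perm (Fin 3)) where
  carrier := {q | ∀ m, q.1.1 * f m = f (q.2 m) * q.1.1 ∨ q.1.1 * f m = (- f (q.2 m)) * q.1.1}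
  one_mem' := by intro m; left; simp
  mul_mem' := by
    rintro ⟨a, s⟩ ⟨b, t⟩ h1 h2 m
    have h1 := h1 (t m)
    have h2 := h2 m
    simp only [Prod.mk_mul_mk, sl_mul_coe, Equiv.Perm.mul_apply] at *
    rcases h1 with h1 | h1 <;> rcases h2 with h2 | h2
    · left; rw [mul_assoc, h2, ← mul_assoc, h1, mul_assoc]
    · right; rw [mul_assoc, h2, ← mul_assoc, mul_neg, h1, neg_mul, neg_mul, mul_assoc]
    · right; rw [mul_assoc, h2, ← mul_assoc, h1, mul_assoc]
    · left; rw [mul_assoc, h2, ← mul_assoc, mul_neg, h1, neg_mul, neg_mul, neg_mul, neg_neg, mul_assoc]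
  inv_mem' := by
    rintro ⟨a, s⟩ h m
    have h := h (s⁻¹ m)
    have e : s (s⁻¹ m) = m := by simp
    simp only [Prod.inv_mk] at *
    rw [e] at h
    rcases h with h | h
    · left; exact sl_inv_rel a _ _ h
    · right
      have := sl_inv_rel a _ _ h
      rw [mul_neg] at this
      rw [neg_mul, ← this, neg_neg]

/-- elements fixing both lines -/
def quatK (i j : M2) : Subgroup SL where
  carrier := {q | (q.1 * i = i * q.1 ∨ q.1 * i = (-i) * q.1) ∧
    (q.1 * j = j * q.1 ∨ q.1 * j = (-j) * q.1)}
  one_mem' := by simp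
  mul_mem' := by
    have key : ∀ (i : M2) (a b : SL), (a.1 * i = i * a.1 ∨ a.1 * i = (-i) * a.1) →
        (b.1 * i = i * b.1 ∨ b.1 * i = (-i) * b.1) →
        ((a.1 * b.1) * i = i * (a.1 * b.1) ∨ (a.1 * b.1) * i = (-i) * (a.1 * b.1)) := by
      rintro i a b (h1 | h1) (h2 | h2)
      · left; rw [mul_assoc, h2, ← mul_assoc, h1, mul_assoc]
      · right; rw [mul_assoc, h2, ← mul_assoc, mul_neg, h1, neg_mul, neg_mul, mul_assoc]
      · right; rw [mul_assoc, h2, ← mul_assoc, h1, mul_assoc]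
      · left; rw [mul_assoc, h2, ← mul_assoc, mul_neg, h1, neg_mul, neg_mul, neg_mul, neg_neg, mul_assoc]
    intro a b h1 h2
    exact ⟨key i a b h1.1 h2.1, key j a b h1.2 h2.2⟩
  inv_mem' := by
    have key : ∀ (i : M2) (a : SL), (a.1 * i = i * a.1 ∨ a.1 * i = (-i) * a.1) →
        ((a⁻¹ : SL).1 * i = i * (a⁻¹ : SL).1 ∨ (a⁻¹ : SL).1 * i = (-i) * (a⁻¹ : SL).1) := by
      rintro i a (h | h)
      · left; exact sl_inv_rel a _ _ h
      · right
        have := sl_inv_rel a _ _ h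
        rw [mul_neg] at this
        rw [neg_mul, ← this, neg_neg]
    intro a h
    exact ⟨key i a h.1, key j a h.2⟩

theorem quatK_solv (h2 : (2 : F) ≠ 0) (i j : M2) (hi : i.det = 1) (hj : j.det = 1)
    (ti : i.trace = 0) (tj : j.trace = 0) (hij : i * j = - (j * i)) :
    Group.IsSolvable (quatK i j) := by
  have hi0 : i ≠ 0 := by rintro rfl; simp at hi
  let R : Subgroup (SL × (Fˣ × Fˣ)) :=
    (normRel i).comap (MonoidHom.prodMap (MonoidHom.id SL) (MonoidHom.fst Fˣ Fˣ)) ⊓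
    (normRel j).comap (MonoidHom.prodMap (MonoidHom.id SL) (MonoidHom.snd Fˣ Fˣ))
  have := solv_of_rel (P := Fˣ × Fˣ) inferInstance R (centSub i) (centSub_solv h2 i hi0 ti) (by
    rintro g ⟨hg, -⟩
    have : g.1 * i = ((1 : Fˣ) : F) • (i * g.1) := hg
    have h : g.1 * i = i * g.1 := by simpa using this
    exact h) (quatK i j : Set SL) (by
    rintro s ⟨h1, h2⟩
    have key : ∀ i : M2, (s.1 * i = i * s.1 ∨ s.1 * i = (-i) * s.1) →
        ∃ c : Fˣ, s.1 * i = (c : F) • (i * s.1) := by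
      rintro i (h | h)
      · exact ⟨1, by simp [h]⟩
      · exact ⟨-1, by simp [h]⟩
    obtain ⟨c, hc⟩ := key i h1
    obtain ⟨d, hd⟩ := key j h2
    exact ⟨(c, d), hc, hd⟩)
  rwa [Subgroup.closure_eq] at this

theorem solv_of_quat (h2 : (2 : F) ≠ 0) (i j : M2) (hii : i * i = -1) (hjj : j * j = -1)
    (hij : i * j = - (j * i)) (S : Set SL)
    (hS : ∀ Z ∈ S, ∃ σ : Equiv.Perm (Fin 3), ∀ m, Z.1 * ![i, j, i * j] m = ![i, j, i * j] (σ m) * Z.1 ∨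
      Z.1 * ![i, j, i * j] m = - ![i, j, i * j] (σ m) * Z.1) :
    Group.IsSolvable (Subgroup.closure S) := by
  have hd : ∀ u : M2, u * u = -1 → u.det ≠ 0 := by
    intro u hu h
    have := congrArg Matrix.det hu
    rw [Matrix.det_mul, h, Matrix.det_neg] at this
    simp at this
  have ti : i.trace = 0 := trace_zero_of_anti h2 j i (hd j hjj) (by rw [hij, neg_neg])
  have tj : j.trace = 0 := trace_zero_of_anti h2 i j (hd i hii) hij
  have d1 : ∀ u : M2, u.trace = 0 → u * u = -1 → u.det = 1 := by
    intro u tu hu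
    rw [sq_traceless u tu] at hu
    have := congrFun (congrFun hu 0) 0
    simpa using this
  refine solv_of_rel solv_perm3 (quatRel ![i, j, i * j]) (quatK i j)
    (quatK_solv h2 i j (d1 i ti hii) (d1 j tj hjj) ti tj hij) ?_ S ?_
  · intro g hg
    exact ⟨hg 0, hg 1⟩
  · intro s hs
    exact hS s hs

end PSLSolv

open Matrix
set_option linter.unusedSimpArgs false
set_option linter.unusedVariables false
set_option linter.deprecated false

section PSLSolv
variable {F : Type*} [Field F]

local notation "M2" => Matrix (Fin 2) (Fin 2) F
local notation "SL" => Matrix.SpecialLinearGroup (Fin 2) F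

theorem solv_of_commute (X Y : SL) (h : X.1 * Y.1 = Y.1 * X.1) :
    Group.IsSolvable (Subgroup.closure {X, Y}) := by
  have h' : X * Y = Y * X := Subtype.ext h
  have := Subgroup.isMulCommutative_closure (k := ({X, Y} : Set SL)) (by
    rintro a (rfl | rfl) b (rfl | rfl) <;> first | rfl | exact h' | exact h'.symm)
  exact Group.isSolvable_of_comm fun a b => mul_comm' a b

theorem normalize_nilp (h2 : (2 : F) ≠ 0) (X : SL) (n : M2) (hn : n ≠ 0) (tn : n.trace = 0)
    (dn : n.det = 0) (h : (vpart X.1 * n).trace = 0) : ∃ c : F, X.1 * n = c • (n * X.1) := by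
  have ha := anti_traceless (vpart X.1) n (vpart_trace _) tn
  rw [h, zero_smul] at ha
  have hnn := sq_traceless n tn
  rw [dn, neg_zero, zero_smul] at hnn
  have ha' : vpart X.1 * n = - (n * vpart X.1) := eq_neg_of_add_eq_zero_left ha
  have hnv : n * vpart X.1 = - (vpart X.1 * n) := by rw [ha', neg_neg]
  obtain ⟨l, hl⟩ := parallel_of_commute h2 n (vpart X.1 * n) hn tn h (by
    rw [← mul_assoc, hnv, neg_mul, mul_assoc, hnn]; simp)
  have e := eq_of_vpart h2 X.1
  set t := X.1.trace
  have e1 : X.1 * n = ((t + l) / 2) • n := by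
    rw [e, add_mul, smul_mul_assoc, smul_mul_assoc, hl, one_mul]
    module
  have e2 : n * X.1 = ((t - l) / 2) • n := by
    rw [e, mul_add, mul_smul_comm, mul_smul_comm, hnv, hl, mul_one]
    module
  by_cases h0 : (t - l) / 2 = 0
  · exfalso
    rw [h0, zero_smul] at e2
    apply hn
    have h1 : X.1 * (X⁻¹ : SL).1 = 1 := by rw [← sl_mul_coe]; simp
    calc n = n * X.1 * (X⁻¹ : SL).1 := by rw [mul_assoc, h1, mul_one]
      _ = 0 := by rw [e2, zero_mul]
  · refine ⟨((t + l) / 2) / ((t - l) / 2), ?_⟩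
    rw [e1, e2, smul_smul, div_mul_cancel₀ _ h0]

theorem trace_vpart_comm (X Y : M2) : (vpart X * (X * Y - Y * X)).trace = 0 := by
  simp only [vpart, Matrix.trace_fin_two, m2_mul_apply, Matrix.sub_apply, Matrix.smul_apply,
    Matrix.one_apply, smul_eq_mul]
  simp
  ring

theorem solv_of_det (h2 : (2 : F) ≠ 0) (X Y : SL) (h : (X.1 * Y.1 - Y.1 * X.1).det = 0) :
    Group.IsSolvable (Subgroup.closure {X, Y}) := by
  by_cases h0 : X.1 * Y.1 - Y.1 * X.1 = 0
  · exact solv_of_commute X Y (sub_eq_zero.mp h0)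
  · have tn : (X.1 * Y.1 - Y.1 * X.1).trace = 0 := by
      rw [Matrix.trace_sub, Matrix.trace_mul_comm, sub_self]
    refine solv_of_normalize h2 _ _ h0 tn ?_
    rintro Z (rfl | rfl)
    · exact normalize_nilp h2 _ _ h0 tn h (trace_vpart_comm _ _)
    · refine normalize_nilp h2 _ _ h0 tn h ?_
      have := trace_vpart_comm Z.1 X.1
      rw [← neg_sub, mul_neg, Matrix.trace_neg, this, neg_zero]

theorem solv_of_tt (h2 : (2 : F) ≠ 0) (X Y : SL) (hX : X.1.trace = 0) (hY : Y.1.trace = 0) :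
    Group.IsSolvable (Subgroup.closure {X, Y}) := by
  by_cases h0 : X.1 * Y.1 - Y.1 * X.1 = 0
  · exact solv_of_commute X Y (sub_eq_zero.mp h0)
  · have tn : (X.1 * Y.1 - Y.1 * X.1).trace = 0 := by
      rw [Matrix.trace_sub, Matrix.trace_mul_comm, sub_self]
    have x2 := sq_traceless X.1 hX
    have y2 := sq_traceless Y.1 hY
    rw [X.2] at x2
    rw [Y.2] at y2
    refine solv_of_normalize h2 _ _ h0 tn ?_
    rintro Z (rfl | rfl)
    · refine ⟨-1, ?_⟩
      rw [mul_sub, sub_mul, ← mul_assoc, x2, mul_assoc Y.1, x2, mul_assoc]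
      simp
      abel
    · refine ⟨-1, ?_⟩
      rw [mul_sub, sub_mul, ← mul_assoc Z.1 Z.1, y2, mul_assoc X.1 Z.1 Z.1, y2, mul_assoc]
      simp

theorem closure_pair_le {G : Type*} [Group G] {x y : G} {K : Subgroup G} (hx : x ∈ K) (hy : y ∈ K) :
    Subgroup.closure {x, y} ≤ K := by
  rw [Subgroup.closure_le]
  rintro z (rfl | rfl)
  · exact hx
  · exact hy

theorem mem_cl_left {G : Type*} [Group G] (x y : G) : x ∈ Subgroup.closure ({x, y} : Set G) :=
  Subgroup.subset_closure (by simp)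

theorem mem_cl_right {G : Type*} [Group G] (x y : G) : y ∈ Subgroup.closure ({x, y} : Set G) :=
  Subgroup.subset_closure (by simp)

theorem solv_of_pairs (h2 : (2 : F) ≠ 0) (X Y : SL)
    (h : (X.1 * Y.1 - Y.1 * X.1).det = 0 ∨ (X.1.trace = 0 ∧ Y.1.trace = 0) ∨
      (X.1.trace = 0 ∧ (X.1 * Y.1).trace = 0) ∨ (Y.1.trace = 0 ∧ (X.1 * Y.1).trace = 0)) :
    Group.IsSolvable (Subgroup.closure {X, Y}) := by
  rcases h with h | ⟨h, h'⟩ | ⟨h, h'⟩ | ⟨h, h'⟩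
  · exact solv_of_det h2 X Y h
  · exact solv_of_tt h2 X Y h h'
  · refine solv_of_le _ _ (closure_pair_le (mem_cl_left X (X * Y)) ?_) (solv_of_tt h2 X (X * Y) h h')
    have := Subgroup.mul_mem _ (Subgroup.inv_mem _ (mem_cl_left X (X * Y))) (mem_cl_right X (X * Y))
    simpa using this
  · refine solv_of_le _ _ (closure_pair_le ?_ (mem_cl_left Y (X * Y))) (solv_of_tt h2 Y (X * Y) h h')
    have := Subgroup.mul_mem _ (mem_cl_right Y (X * Y)) (Subgroup.inv_mem _ (mem_cl_left Y (X * Y)))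
    simpa using this

theorem cayley_sl (g : M2) (hg : g.det = 1) : g * g = g.trace • g - 1 := by
  rw [Matrix.det_fin_two] at hg
  ext i j; fin_cases i <;> fin_cases j <;> simp [m2_mul_apply, Matrix.trace_fin_two] <;>
    first | linear_combination (0 : F) * hg | linear_combination -hg

theorem anti_gen (g y : M2) (ty : y.trace = 0) :
    y * g = g.trace • y + (g * y).trace • (1 : M2) - g * y := by
  rw [Matrix.trace_fin_two] at ty
  have h1 : y 1 1 = - y 0 0 := by linear_combination ty
  ext i j; fin_cases i <;> fin_cases j <;> simp [m2_mul_apply, Matrix.trace_fin_two, h1] <;> ring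


theorem solv_tet_aux (G Y : M2) (r1 : G * G = G - 1) (r2 : Y * Y = -1) (r3 : Y * G = Y + 1 - G * Y) :
    let j := G * Y - G - Y
    j * j = -1 ∧ Y * j = - (j * Y) ∧ G * Y = j * G ∧ G * j = - (Y * j) * G ∧ G * (Y * j) = - Y * G ∧
    Y * (Y * j) = - (Y * j) * Y := by
  have r1' : ∀ z, G * (G * z) = G * z - z := fun z => by rw [← mul_assoc, r1]; noncomm_ring
  have r2' : ∀ z, Y * (Y * z) = -z := fun z => by rw [← mul_assoc, r2]; noncomm_ring
  have r3' : ∀ z, Y * (G * z) = Y * z + z - G * (Y * z) := fun z => by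
    rw [← mul_assoc, r3]; noncomm_ring
  intro j
  refine ⟨?_, ?_, ?_, ?_, ?_, ?_⟩ <;>
  · simp only [j, mul_sub, sub_mul, mul_add, add_mul, mul_assoc, r1, r2, r3, r1', r2', r3', mul_neg,
      neg_mul, mul_one, one_mul]
    abel

theorem solv_oct_aux (t : F) (ht : t ^ 2 = 2) (G Y : M2) (r1 : G * G = t • G - 1) (r2 : Y * Y = -1)
    (r3 : Y * G = t • Y + 1 - G * Y) :
    let i := t • G - 1
    let j := 1 - t • Y - t • G
    i * i = -1 ∧ j * j = -1 ∧ i * j = - (j * i) ∧ G * i = i * G ∧ G * j = (i * j) * G ∧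
    G * (i * j) = - j * G ∧ Y * i = j * Y ∧ Y * j = i * Y ∧ Y * (i * j) = - (i * j) * Y := by
  have r1' : ∀ z, G * (G * z) = t • (G * z) - z := fun z => by
    rw [← mul_assoc, r1, sub_mul, smul_mul_assoc, one_mul]
  have r2' : ∀ z, Y * (Y * z) = -z := fun z => by rw [← mul_assoc, r2]; noncomm_ring
  have r3' : ∀ z, Y * (G * z) = t • (Y * z) + z - G * (Y * z) := fun z => by
    rw [← mul_assoc, r3, sub_mul, add_mul, smul_mul_assoc, one_mul, mul_assoc]
  have r4 : ∀ z : M2, t • (t • z) = z + z := fun z => by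
    rw [smul_smul, ← pow_two, ht, two_smul]
  intro i j
  refine ⟨?_, ?_, ?_, ?_, ?_, ?_, ?_, ?_, ?_⟩ <;>
  · simp only [i, j, mul_sub, sub_mul, mul_add, add_mul, mul_assoc, r1, r2, r3, r1', r2', r3', mul_neg,
      neg_mul, mul_one, one_mul, smul_mul_assoc, mul_smul_comm, smul_sub, smul_add, smul_neg, r4]
    try abel

theorem solv_tet (h2 : (2 : F) ≠ 0) (g y : SL) (tg : g.1.trace = 1) (ty : y.1.trace = 0)
    (tgy : (g.1 * y.1).trace = 1) : Group.IsSolvable (Subgroup.closure {g, y}) := by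
  have r1 := cayley_sl g.1 g.2
  have r2 := cayley_sl y.1 y.2
  have r3 := anti_gen g.1 y.1 ty
  rw [tg, one_smul] at r1
  rw [ty, zero_smul, zero_sub] at r2
  rw [tg, tgy, one_smul, one_smul] at r3
  obtain ⟨a1, a2, a3, a4, a5, a6⟩ := solv_tet_aux g.1 y.1 r1 r2 r3
  refine solv_of_quat h2 y.1 (g.1 * y.1 - g.1 - y.1) r2 a1 a2 _ ?_
  rintro Z (rfl | rfl)
  · refine ⟨finRotate 3, ?_⟩
    intro m
    fin_cases m
    · left; exact a3
    · right; exact a4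
    · right; exact a5
  · refine ⟨1, ?_⟩
    intro m
    fin_cases m
    · left; rfl
    · right; exact a2.trans (neg_mul _ _).symm
    · right; exact a6

theorem solv_oct (h2 : (2 : F) ≠ 0) (g y : SL) (tg : g.1.trace ^ 2 = 2) (ty : y.1.trace = 0)
    (tgy : (g.1 * y.1).trace = 1) : Group.IsSolvable (Subgroup.closure {g, y}) := by
  have r1 := cayley_sl g.1 g.2
  have r2 := cayley_sl y.1 y.2
  have r3 := anti_gen g.1 y.1 ty
  rw [ty, zero_smul, zero_sub] at r2
  rw [tgy, one_smul] at r3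
  obtain ⟨a1, a2, a3, a4, a5, a6, a7, a8, a9⟩ := solv_oct_aux g.1.trace tg g.1 y.1 r1 r2 r3
  refine solv_of_quat h2 _ _ a1 a2 a3 _ ?_
  rintro Z (rfl | rfl)
  · refine ⟨Equiv.swap 1 2, ?_⟩
    intro m
    fin_cases m
    · left; exact a4
    · left; exact a5
    · right; exact a6
  · refine ⟨Equiv.swap 0 1, ?_⟩
    intro m
    fin_cases m
    · left; exact a7
    · left; exact a8
    · right; exact a9

end PSLSolv

open Matrix
set_option linter.unusedSimpArgs false
set_option linter.unusedVariables false
set_option linter.deprecated false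

section PSLSolv
variable {F : Type*} [Field F]

local notation "M2" => Matrix (Fin 2) (Fin 2) F
local notation "SL" => Matrix.SpecialLinearGroup (Fin 2) F

/-- solvabilizer upstairs -/
def Ssol (X : SL) : Set SL := {Y | Group.IsSolvable (Subgroup.closure {X, Y})}

theorem Ssol_symm (X Y : SL) : Y ∈ Ssol X ↔ X ∈ Ssol Y := by
  unfold Ssol
  rw [Set.mem_setOf_eq, Set.mem_setOf_eq, Set.pair_comm]

theorem comm_vpart (X Y : M2) :
    vpart X * vpart Y - vpart Y * vpart X = (4 : F) • (X * Y - Y * X) := by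
  simp only [vpart, mul_sub, sub_mul, smul_mul_assoc, mul_smul_comm, mul_one, one_mul]
  module

theorem det_comm_vpart (h2 : (2 : F) ≠ 0) (X Y : M2) :
    (vpart X * vpart Y - vpart Y * vpart X).det = 0 ↔ (X * Y - Y * X).det = 0 := by
  have h4 : (4 : F) ≠ 0 := by
    have : (4 : F) = 2 * 2 := by norm_num
    rw [this]; exact mul_ne_zero h2 h2
  rw [comm_vpart, Matrix.det_smul]
  simp [h4]

theorem trace_mul_vpart (X Y : M2) :
    4 * (X * Y).trace = 2 * X.trace * Y.trace + (vpart X * vpart Y).trace := by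
  simp only [vpart, Matrix.trace_fin_two, m2_mul_apply, Matrix.sub_apply, Matrix.smul_apply,
    Matrix.one_apply, smul_eq_mul]
  simp
  ring

/-- generic elements -/
def IsGen (U : SL) : Prop := vpart U.1 ≠ 0 ∧ U.1.trace ≠ 0 ∧ U.1.trace ^ 2 ≠ 1 ∧ U.1.trace ^ 2 ≠ 2

theorem gen_iff (h2 : (2 : F) ≠ 0) (U : SL) (hU : IsGen U) (Y : SL) :
    Y ∈ Ssol U ↔ (vpart U.1 * vpart Y.1 - vpart Y.1 * vpart U.1).det = 0 ∨
      (Y.1.trace = 0 ∧ (vpart U.1 * vpart Y.1).trace = 0) := by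
  have h4 : (4 : F) ≠ 0 := by
    have : (4 : F) = 2 * 2 := by norm_num
    rw [this]; exact mul_ne_zero h2 h2
  obtain ⟨u0, u1, u2, u3⟩ := hU
  have tm := trace_mul_vpart U.1 Y.1
  rw [det_comm_vpart h2]
  constructor
  · intro h
    rcases nec_of_solvable h2 U Y h with (h | ⟨h, -⟩ | ⟨h, -⟩ | ⟨h, h'⟩) | ⟨h, -⟩
    · exact Or.inl h
    · exact absurd h u1
    · exact absurd h u1
    · refine Or.inr ⟨h, ?_⟩
      rw [h, h'] at tm
      linear_combination -tm
    · rcases h with h | h | h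
      · exact absurd (pow_eq_zero_iff (two_ne_zero) |>.mp h) u1
      · exact absurd h u2
      · exact absurd h u3
  · intro h
    apply solv_of_pairs h2
    rcases h with h | ⟨h, h'⟩
    · exact Or.inl h
    · refine Or.inr (Or.inr (Or.inr ⟨h, ?_⟩))
      rw [h, h'] at tm
      have : 4 * (U.1 * Y.1).trace = 0 := by linear_combination tm
      exact (mul_eq_zero.mp this).resolve_left h4

theorem gen_eq (h2 : (2 : F) ≠ 0) (U U' : SL) (hU : IsGen U) (hU' : IsGen U') (c : F)
    (h : vpart U'.1 = c • vpart U.1) : Ssol U' = Ssol U := by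
  have hc : c ≠ 0 := by
    rintro rfl
    exact hU'.1 (by rw [h, zero_smul])
  ext Y
  rw [gen_iff h2 U hU, gen_iff h2 U' hU', h, smul_mul_assoc, mul_smul_comm, ← smul_sub,
    Matrix.det_smul, Matrix.trace_smul]
  simp [hc]

theorem exists_perp (h2 : (2 : F) ≠ 0) (v : M2) (hv : v ≠ 0) (tv : v.trace = 0) :
    ∃ w : M2, w.trace = 0 ∧ (v * w).trace = 0 ∧ w.det ≠ 0 := by
  rw [Matrix.trace_fin_two] at tv
  have h1 : v 1 1 = - v 0 0 := by linear_combination tv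
  by_cases hb : v 0 1 = 0
  · by_cases hc : v 1 0 = 0
    · refine ⟨!![0, 1; 1, 0], ?_, ?_, ?_⟩ <;> simp [Matrix.trace_fin_two, m2_mul_apply, hb, hc]
    · refine ⟨!![v 1 0, -2 * v 0 0; 0, - v 1 0], ?_, ?_, ?_⟩ <;>
        simp [Matrix.trace_fin_two, m2_mul_apply, hb, hc, h1]
      ring
  · refine ⟨!![v 0 1, 0; -2 * v 0 0, - v 0 1], ?_, ?_, ?_⟩ <;>
        simp [Matrix.trace_fin_two, m2_mul_apply, hb, h1]
    ring

theorem exists_nonperp_nilp (h2 : (2 : F) ≠ 0) (v : M2) (hv : v ≠ 0) (tv : v.trace = 0) :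
    ∃ w : M2, w ≠ 0 ∧ w.trace = 0 ∧ (v * w).trace ≠ 0 ∧ w.det = 0 := by
  rw [Matrix.trace_fin_two] at tv
  have h1 : v 1 1 = - v 0 0 := by linear_combination tv
  by_cases hb : v 0 1 = 0
  · by_cases hc : v 1 0 = 0
    · have ha : v 0 0 ≠ 0 := by
        intro ha
        apply hv
        ext i j; fin_cases i <;> fin_cases j <;> simp [ha, hb, hc, h1]
      refine ⟨!![1, 1; -1, -1], ?_, ?_, ?_, ?_⟩
      · intro h
        have := congrFun (congrFun h 0) 0
        simp at this
      · simp [Matrix.trace_fin_two]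
      · simp [Matrix.trace_fin_two, m2_mul_apply, hb, hc, h1]
        rw [← two_mul]
        exact mul_ne_zero h2 ha
      · simp
    · refine ⟨!![0, 1; 0, 0], ?_, ?_, ?_, ?_⟩
      · intro h
        have := congrFun (congrFun h 0) 1
        simp at this
      · simp [Matrix.trace_fin_two]
      · simp [Matrix.trace_fin_two, m2_mul_apply, hb, hc, h1]
      · simp
  · refine ⟨!![0, 0; 1, 0], ?_, ?_, ?_, ?_⟩
    · intro h
      have := congrFun (congrFun h 1) 0
      simp at this
    · simp [Matrix.trace_fin_two]
    · simp [Matrix.trace_fin_two, m2_mul_apply, hb, h1]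
    · simp

theorem exists_y [Finite F] (h2 : (2 : F) ≠ 0) (g : SL) (hg : vpart g.1 ≠ 0) (ht : 4 - g.1.trace ^ 2 ≠ 0) :
    ∃ y : SL, y.1.trace = 0 ∧ (g.1 * y.1).trace = 1 := by
  have := Fintype.ofFinite F
  obtain ⟨w, tw, hvw, dw⟩ := exists_perp h2 _ hg (vpart_trace g.1)
  set v := vpart g.1 with hv
  set d := 4 - g.1.trace ^ 2 with hd
  have dv : v.det = d := vpart_det g.1 g.2
  have tv : v.trace = 0 := vpart_trace g.1
  clear_value d
  have hq : ∃ a b : F, a ^ 2 + d * b ^ 2 = (1 - 1 / d) / w.det := by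
    open Polynomial in
    obtain ⟨a, b, hab⟩ := FiniteField.exists_root_sum_quadratic (R := F)
      (f := X ^ 2) (g := C d * X ^ 2 - C ((1 - 1 / d) / w.det)) (degree_X_pow 2)
      (by compute_degree!) (by
        by_contra h
        have h3 := FiniteField.even_card_iff_char_two.mpr (show Fintype.card F % 2 = 0 by omega)
        have := ringChar.Nat.cast_ringChar (R := F)
        rw [h3] at this
        exact h2 (by exact_mod_cast this))
    refine ⟨a, b, ?_⟩
    simp at hab
    rw [div_eq_mul_inv, one_div]
    rw [div_eq_mul_inv] at hab
    linear_combination hab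
  obtain ⟨a, b, hab⟩ := hq
  have key : ((-1 / d) • v + a • w + b • (v * w)).det = 1 := by
    have e : ((-1 / d) • v + a • w + b • (v * w)).det = 1 / d ^ 2 * v.det + a ^ 2 * w.det + b ^ 2 * (v.det * w.det) := by
      rw [Matrix.trace_fin_two] at tv tw hvw
      have h1 : v 1 1 = - v 0 0 := by linear_combination tv
      have h1' : w 1 1 = - w 0 0 := by linear_combination tw
      simp only [m2_mul_apply, h1, h1'] at hvw
      simp only [Matrix.det_fin_two, m2_mul_apply, Matrix.add_apply, Matrix.smul_apply, smul_eq_mul, h1, h1']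
      linear_combination (-(-1 / d) * a) * hvw
    rw [e, dv]
    field_simp at hab ⊢
    linear_combination hab
  refine ⟨⟨_, key⟩, ?_, ?_⟩
  · simp [Matrix.trace_add, Matrix.trace_smul, tv, tw, hvw]
  · have e := eq_of_vpart h2 g.1
    have vv := sq_traceless v tv
    change (g.1 * ((-1 / d) • v + a • w + b • (v * w))).trace = 1
    rw [e, ← hv, add_mul, Matrix.trace_add]
    simp only [smul_mul_assoc, mul_smul_comm, mul_add, ← mul_assoc, vv, one_mul, Matrix.trace_add,
      Matrix.trace_smul, tv, tw, hvw, dv, Matrix.trace_one, smul_zero, Fintype.card_fin, smul_eq_mul]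
    push_cast
    field_simp
    ring

end PSLSolv

open Matrix
set_option linter.unusedSimpArgs false
set_option linter.unusedVariables false
set_option linter.deprecated false

section PSLSolv
variable {F : Type*} [Field F]

local notation "M2" => Matrix (Fin 2) (Fin 2) F
local notation "SL" => Matrix.SpecialLinearGroup (Fin 2) F

/-- a condition ensuring generic elements exist on each line -/
def HasGen (F : Type*) [Field F] : Prop :=
  ∀ d : F, ∃ s c : F, s ^ 2 + d * c ^ 2 = 1 ∧ c ≠ 0 ∧ s ≠ 0 ∧ (2 * s) ^ 2 ≠ 1 ∧ (2 * s) ^ 2 ≠ 2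

theorem exists_gen (h2 : (2 : F) ≠ 0) (hF : HasGen F) (w : M2) (hw : w ≠ 0) (tw : w.trace = 0) :
    ∃ U : SL, IsGen U ∧ ∃ c : F, c ≠ 0 ∧ vpart U.1 = c • w := by
  obtain ⟨s, c, h1, hc, hs, h3, h4⟩ := hF w.det
  have key : (s • (1 : M2) + c • w).det = 1 := by
    rw [Matrix.trace_fin_two] at tw
    have h : w 1 1 = - w 0 0 := by linear_combination tw
    simp [Matrix.det_fin_two, h] at h1 ⊢
    linear_combination h1
  have ht : (s • (1 : M2) + c • w).trace = 2 * s := by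
    simp [Matrix.trace_add, Matrix.trace_smul, tw, mul_comm]
  have hv : vpart (s • (1 : M2) + c • w) = (2 * c) • w := by
    rw [vpart, ht]; module
  refine ⟨⟨_, key⟩, ⟨?_, ?_, ?_, ?_⟩, 2 * c, mul_ne_zero h2 hc, hv⟩
  · change vpart (s • (1 : M2) + c • w) ≠ 0
    rw [hv]
    exact smul_ne_zero (mul_ne_zero h2 hc) hw
  · change (s • (1 : M2) + c • w).trace ≠ 0
    rw [ht]; exact mul_ne_zero h2 hs
  · change (s • (1 : M2) + c • w).trace ^ 2 ≠ 1
    rwa [ht]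
  · change (s • (1 : M2) + c • w).trace ^ 2 ≠ 2
    rwa [ht]

/-- the generic condition -/
def Pc (v : M2) (b : Prop) (w : M2) : Prop := (v * w - w * v).det = 0 ∨ (b ∧ (v * w).trace = 0)

theorem mem_gen (h2 : (2 : F) ≠ 0) (X U : SL) (hU : IsGen U) (c : F) (hc : c ≠ 0) (w : M2)
    (h : vpart U.1 = c • w) : U ∈ Ssol X ↔ Pc (vpart X.1) (X.1.trace = 0) w := by
  rw [Ssol_symm, gen_iff h2 U hU, h, smul_mul_assoc, mul_smul_comm, ← smul_sub,
    Matrix.det_smul, Matrix.trace_smul, Pc, Matrix.trace_mul_comm w]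
  rw [← neg_sub (w * vpart X.1), Matrix.det_neg]
  simp [hc]

theorem Pc_of_eq (h2 : (2 : F) ≠ 0) (hF : HasGen F) (X X' : SL) (h : Ssol X = Ssol X') (w : M2)
    (tw : w.trace = 0) :
    Pc (vpart X.1) (X.1.trace = 0) w ↔ Pc (vpart X'.1) (X'.1.trace = 0) w := by
  by_cases hw : w = 0
  · subst hw
    simp [Pc]
  · obtain ⟨U, hU, c, hc, hc'⟩ := exists_gen h2 hF w hw tw
    rw [← mem_gen h2 X U hU c hc w hc', ← mem_gen h2 X' U hU c hc w hc', h]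

theorem nilp_eigen (h2 : (2 : F) ≠ 0) (v n : M2) (tv : v.trace = 0) (hn : n ≠ 0) (tn : n.trace = 0)
    (dn : n.det = 0) (h : (v * n).trace = 0) : ∃ l : F, v * n = l • n ∧ n * v = - (l • n) := by
  have ha := anti_traceless v n tv tn
  rw [h, zero_smul] at ha
  have hnn := sq_traceless n tn
  rw [dn, neg_zero, zero_smul] at hnn
  have ha' : v * n = - (n * v) := eq_neg_of_add_eq_zero_left ha
  have hnv : n * v = - (v * n) := by rw [ha', neg_neg]
  obtain ⟨l, hl⟩ := parallel_of_commute h2 n (v * n) hn tn h (by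
    rw [← mul_assoc, hnv, neg_mul, mul_assoc, hnn]; simp)
  exact ⟨l, hl, by rw [hnv, hl]⟩

theorem par_of_two_nilp (h2 : (2 : F) ≠ 0) (v n : M2) (tv : v.trace = 0) (hv : v ≠ 0) (hn : n ≠ 0)
    (tn : n.trace = 0) (dv : v.det = 0)
    (dn : n.det = 0) (h : (v * n).trace = 0) : v * n = n * v := by
  obtain ⟨l, h1, h1'⟩ := nilp_eigen h2 v n tv hn tn dn h
  have vv := sq_traceless v tv
  rw [dv, neg_zero, zero_smul] at vv
  have : v * (v * n) = (l * l) • n := by rw [h1, mul_smul_comm, h1, smul_smul]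
  rw [← mul_assoc, vv, zero_mul] at this
  have hl : l = 0 := by
    rcases smul_eq_zero.mp this.symm with h | h
    · simpa using h
    · exact absurd h hn
  rw [h1, h1', hl]; simp

theorem par_aux (h2 : (2 : F) ≠ 0) (v v' : M2) (b b' : Prop) (tv : v.trace = 0) (tv' : v'.trace = 0)
    (dv : v.det ≠ 0) (hD : (v * v' - v' * v).det = 0)
    (hP : ∀ w : M2, w.trace = 0 → Pc v b w → Pc v' b' w) : v * v' = v' * v := by
  set k := (v * v').trace / (2 * v.det) with hk
  set m := v' + k • v with hm
  have vv := sq_traceless v tv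
  have tm : m.trace = 0 := by simp [hm, Matrix.trace_add, Matrix.trace_smul, tv, tv']
  have tvm : (v * m).trace = 0 := by
    rw [hm, mul_add, mul_smul_comm, vv]
    simp [Matrix.trace_add, Matrix.trace_smul]
    rw [hk]; field_simp; ring
  have dm : m.det = 0 := by
    have h1 : v * m - m * v = v * v' - v' * v := by
      rw [hm, mul_add, add_mul, mul_smul_comm, smul_mul_assoc]; abel
    rw [← h1, det_comm_traceless v m tv tm, tvm] at hD
    have : 4 * v.det * m.det = 0 := by linear_combination hD
    have h4 : (4 : F) ≠ 0 := by
      have : (4 : F) = 2 * 2 := by norm_num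
      rw [this]; exact mul_ne_zero h2 h2
    simpa [h4, dv] using this
  have hv' : v' = m - k • v := by rw [hm]; abel
  by_cases hm0 : m = 0
  · rw [hv', hm0]; simp
  exfalso
  obtain ⟨l, l1, l2⟩ := nilp_eigen h2 v m tv hm0 tm dm tvm
  have hll : l * l = - v.det := by
    have h : v * (v * m) = (l * l) • m := by rw [l1, mul_smul_comm, l1, smul_smul]
    rw [← mul_assoc, vv, smul_mul_assoc, one_mul, ← sub_eq_zero, ← sub_smul] at h
    rcases smul_eq_zero.mp h with h | h
    · linear_combination -h
    · exact absurd h hm0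
  have p1 : (v - l • 1) * (v + l • 1) = 0 := by
    rw [sub_mul, mul_add, vv, ← hll]; simp [mul_add, smul_smul]; abel
  have p2 : (v + l • 1) * (v - l • 1) = 0 := by
    rw [mul_sub, add_mul, vv, ← hll]; simp [add_mul, smul_smul]; abel
  have hE : ∀ E : M2, (((v + l • 1) * v' * (v - l • 1)) * E).trace = 0 := by
    intro E
    set u := (v - l • 1) * E * (v + l • 1) with hu
    have tu : u.trace = 0 := by
      rw [hu, Matrix.trace_mul_comm, ← mul_assoc, p2, zero_mul, Matrix.trace_zero]
    have du : u.det = 0 := by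
      have := congrArg Matrix.det p1
      rw [Matrix.det_mul, Matrix.det_zero] at this
      rw [hu, Matrix.det_mul, Matrix.det_mul]
      linear_combination E.det * this
    have hvu : v * u = -l • u := by
      have : v * (v - l • 1) = -l • (v - l • 1) := by
        rw [mul_sub, vv, ← hll, mul_smul_comm, mul_one]; module
      rw [hu, ← mul_assoc, ← mul_assoc, this, smul_mul_assoc, smul_mul_assoc]
    have hP1 : Pc v b u := by
      left
      rw [det_comm_traceless v u tv tu, du, hvu, Matrix.trace_smul, tu]; simp
    have hP2 := hP u tu hP1
    have : (v' * u).trace = 0 := by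
      rcases hP2 with h | h
      · rw [det_comm_traceless v' u tv' tu, du] at h
        simpa using h
      · exact h.2
    have q : (v + l • 1) * v' * (v - l • 1) * E = (v + l • 1) * (v' * (v - l • 1) * E) := by
      simp only [mul_assoc]
    rw [q, Matrix.trace_mul_comm, ← this, hu]
    congr 1
    simp only [mul_assoc]
  have hz : (v + l • 1) * v' * (v - l • 1) = 0 := by
    apply Matrix.ext_iff_trace_mul_right.mpr
    intro x
    rw [hE, zero_mul, Matrix.trace_zero]
  have hz2 : (v + l • 1) * v' * (v - l • 1) = (-4 * (l * l)) • m := by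
    have q : (v + l • 1) * v * (v - l • 1) = 0 := by
      have : (v + l • 1) * v = v * (v + l • 1) := by simp [mul_add, add_mul]
      rw [this, mul_assoc, p2, mul_zero]
    have q1 : (v + l • 1) * m = (2 * l) • m := by
      rw [add_mul, l1, smul_mul_assoc, one_mul]; module
    have q2 : m * (v - l • 1) = (-2 * l) • m := by
      rw [mul_sub, l2, mul_smul_comm, mul_one]; module
    rw [hv', mul_sub (v + l • 1) m, sub_mul, mul_smul_comm, smul_mul_assoc, q, q1, smul_mul_assoc, q2]
    module
  rw [hz2, hll] at hz
  have h4 : (4 : F) ≠ 0 := by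
    have : (4 : F) = 2 * 2 := by norm_num
    rw [this]; exact mul_ne_zero h2 h2
  rcases smul_eq_zero.mp hz with h | h
  · simp [h4, dv] at h
  · exact hm0 h

theorem det_comm_swap (v w : M2) : (v * w - w * v).det = (w * v - v * w).det := by
  rw [← neg_sub, Matrix.det_neg]; simp

theorem commute_of_Pc (h2 : (2 : F) ≠ 0) (v v' : M2) (b b' : Prop) (hv : v ≠ 0) (hv' : v' ≠ 0)
    (tv : v.trace = 0) (tv' : v'.trace = 0)
    (hP : ∀ w : M2, w.trace = 0 → (Pc v b w ↔ Pc v' b' w)) : v * v' = v' * v := by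
  by_cases hD : (v * v' - v' * v).det = 0
  · by_cases dv : v.det = 0
    · by_cases dv' : v'.det = 0
      · refine par_of_two_nilp h2 v v' tv hv hv' tv' dv dv' ?_
        rw [det_comm_traceless v v' tv tv', dv] at hD
        simpa using hD
      · exact (par_aux h2 v' v b' b tv' tv dv' (by rw [det_comm_swap]; exact hD)
          (fun w tw => (hP w tw).mpr)).symm
    · exact par_aux h2 v v' b b' tv tv' dv hD (fun w tw => (hP w tw).mp)
  · exfalso
    have h1 := (hP v tv).mp (Or.inl (by simp))
    rcases h1 with h1 | ⟨hb', h1⟩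
    · rw [det_comm_swap] at h1; exact hD h1
    have h1' := (hP v' tv').mpr (Or.inl (by simp))
    rcases h1' with h1' | ⟨hb, h1'⟩
    · exact hD h1'
    rw [det_comm_traceless v v' tv tv', h1'] at hD
    have dv : v.det ≠ 0 := by rintro h; apply hD; rw [h]; ring
    have dv' : v'.det ≠ 0 := by rintro h; apply hD; rw [h]; ring
    have vv := sq_traceless v tv
    have vv' := sq_traceless v' tv'
    have tw : (v' + v * v').trace = 0 := by rw [Matrix.trace_add, tv', h1', add_zero]
    have e1 : (v * (v' + v * v')).trace = 0 := by
      rw [mul_add, ← mul_assoc, vv, Matrix.trace_add, h1', smul_mul_assoc, one_mul, Matrix.trace_smul, tv']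
      simp
    have e2 : (v' * (v' + v * v')).trace = - 2 * v'.det := by
      rw [mul_add, vv', Matrix.trace_add, Matrix.trace_mul_comm v' (v * v'), mul_assoc, vv',
        mul_smul_comm, mul_one, Matrix.trace_smul, Matrix.trace_smul, tv]
      simp; ring
    have e3 : (v' + v * v').det = v'.det * (1 + v.det) := by
      rw [Matrix.trace_fin_two] at tv tv' h1'
      have a1 : v 1 1 = - v 0 0 := by linear_combination tv
      have a2 : v' 1 1 = - v' 0 0 := by linear_combination tv'
      simp only [Matrix.det_fin_two, Matrix.add_apply, m2_mul_apply, a1, a2]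
      ring
    have h4 : (4 : F) ≠ 0 := by
      have : (4 : F) = 2 * 2 := by norm_num
      rw [this]; exact mul_ne_zero h2 h2
    rcases (hP _ tw).mp (Or.inr ⟨hb, e1⟩) with h | ⟨-, h⟩
    · rw [det_comm_traceless v' _ tv' tw, e2, e3] at h
      have : 4 * (v'.det * v'.det) * v.det = 0 := by linear_combination h
      simp [h4, dv, dv'] at this
    · rw [e2] at h
      simp [h2, dv'] at h

theorem sameline (h2 : (2 : F) ≠ 0) (hF : HasGen F) (X X' : SL) (hX : vpart X.1 ≠ 0)
    (hX' : vpart X'.1 ≠ 0) (h : Ssol X = Ssol X') : ∃ c : F, c ≠ 0 ∧ vpart X'.1 = c • vpart X.1 := by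
  have := commute_of_Pc h2 _ _ _ _ hX hX' (vpart_trace _) (vpart_trace _) (Pc_of_eq h2 hF X X' h)
  obtain ⟨c, hc⟩ := parallel_of_commute h2 _ _ hX (vpart_trace _) (vpart_trace _) this
  refine ⟨c, ?_, hc⟩
  rintro rfl
  exact hX' (by rw [hc, zero_smul])

theorem trzero_aux (h2 : (2 : F) ≠ 0) (hF : HasGen F) (X X' : SL) (hX : vpart X.1 ≠ 0)
    (hX' : vpart X'.1 ≠ 0) (h : Ssol X = Ssol X') (ht : X.1.trace = 0) : X'.1.trace = 0 := by
  obtain ⟨c, hc, hcc⟩ := sameline h2 hF X X' hX hX' h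
  obtain ⟨w, tw, h1, dw⟩ := exists_perp h2 _ hX (vpart_trace _)
  have h4 : (4 : F) ≠ 0 := by
    have : (4 : F) = 2 * 2 := by norm_num
    rw [this]; exact mul_ne_zero h2 h2
  rcases (Pc_of_eq h2 hF X X' h w tw).mp (Or.inr ⟨ht, h1⟩) with h | h
  · exfalso
    rw [det_comm_traceless _ w (vpart_trace _) tw, hcc, smul_mul_assoc, Matrix.trace_smul, h1,
      Matrix.det_smul, vpart_det X.1 X.2, ht] at h
    simp [h4, hc, dw] at h
  · exact h.1

theorem trzero_iff (h2 : (2 : F) ≠ 0) (hF : HasGen F) (X X' : SL) (hX : vpart X.1 ≠ 0)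
    (hX' : vpart X'.1 ≠ 0) (h : Ssol X = Ssol X') : X.1.trace = 0 ↔ X'.1.trace = 0 :=
  ⟨trzero_aux h2 hF X X' hX hX' h, trzero_aux h2 hF X' X hX' hX h.symm⟩

theorem Ssol_ne_univ (h2 : (2 : F) ≠ 0) (hF : HasGen F) (X : SL) (hX : vpart X.1 ≠ 0) :
    Ssol X ≠ Set.univ := by
  intro h
  obtain ⟨w, w0, tw, h1, dw⟩ := exists_nonperp_nilp h2 _ hX (vpart_trace _)
  obtain ⟨U, hU, c, hc, hc'⟩ := exists_gen h2 hF w w0 tw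
  have := (mem_gen h2 X U hU c hc w hc').mp (by rw [h]; trivial)
  rcases this with h | h
  · rw [det_comm_traceless _ w (vpart_trace _) tw, dw] at h
    simp [h1] at h
  · exact h1 h.2

theorem Ssol_central (h2 : (2 : F) ≠ 0) (X : SL) (hX : vpart X.1 = 0) : Ssol X = Set.univ := by
  ext Y
  simp only [Set.mem_univ, iff_true]
  apply solv_of_commute
  apply commute_of_vpart h2
  rw [hX]; simp

/-- kinds 3, 4 and generic are distinguished -/
theorem kind_aux [Finite F] (h2 : (2 : F) ≠ 0) (h3 : (3 : F) ≠ 0) (hF : HasGen F) (g h : SL)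
    (hg : g.1.trace = 1 ∨ g.1.trace ^ 2 = 2) (hh : vpart h.1 ≠ 0) (hS : Ssol g = Ssol h) :
    h.1.trace ^ 2 = g.1.trace ^ 2 := by
  have h4 : (4 : F) ≠ 0 := by
    have : (4 : F) = 2 * 2 := by norm_num
    rw [this]; exact mul_ne_zero h2 h2
  have dg : (vpart g.1).det ≠ 0 := by
    rw [vpart_det g.1 g.2]
    rcases hg with hg | hg
    · rw [hg]; intro h; apply h3; linear_combination h
    · rw [hg]; intro h; apply h2; linear_combination h
  have hg0 : vpart g.1 ≠ 0 := by
    intro h; rw [h] at dg; simp at dg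
  have tg0 : g.1.trace ≠ 0 := by
    intro h; rw [h] at hg; rcases hg with hg | hg
    · simp at hg
    · apply h2; rw [← hg]; ring
  have th0 : h.1.trace ≠ 0 := fun e => tg0 ((trzero_iff h2 hF g h hg0 hh hS).mpr e)
  obtain ⟨c, hc, hcc⟩ := sameline h2 hF g h hg0 hh hS
  rw [vpart_det g.1 g.2] at dg
  obtain ⟨y, ty, tgy⟩ := exists_y h2 g hg0 dg
  have hy : y ∈ Ssol g := by
    rcases hg with hg | hg
    · exact solv_tet h2 g y hg ty tgy
    · exact solv_oct h2 g y hg ty tgy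
  rw [hS] at hy
  have tm := trace_mul_vpart g.1 y.1
  have tm' := trace_mul_vpart h.1 y.1
  rw [hcc, smul_mul_assoc, Matrix.trace_smul, ty] at tm'
  rw [ty, tgy] at tm
  have thy : (h.1 * y.1).trace = c := by
    apply mul_left_cancel₀ h4
    rw [tm']; simp at tm; rw [← tm]; simp [mul_comm]
  have dc := congrArg Matrix.det hcc
  rw [Matrix.det_smul, vpart_det g.1 g.2, vpart_det h.1 h.2] at dc
  simp only [Fintype.card_fin] at dc
  rcases nec_of_solvable h2 h y hy with (e | ⟨e, -⟩ | ⟨e, -⟩ | ⟨-, e⟩) | ⟨e1, -, e2⟩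
  · exfalso
    rw [← det_comm_vpart h2, hcc, smul_mul_assoc, mul_smul_comm, ← smul_sub, Matrix.det_smul] at e
    have e' : (vpart g.1 * vpart y.1 - vpart y.1 * vpart g.1).det = 0 := by
      simpa [hc] using e
    rw [det_comm_vpart h2, det_comm g.1 y.1 g.2 y.2, ty, tgy] at e'
    rcases hg with hg | hg
    · apply h2; rw [hg] at e'; linear_combination e'
    · rw [hg] at e'; apply one_ne_zero (α := F); linear_combination e'
  · exact absurd e th0
  · exact absurd e th0
  · rw [thy] at e; exact absurd e hc
  · rw [thy] at e2
    have f0 : c ^ 2 ≠ 0 := pow_ne_zero 2 hc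
    have f1 : h.1.trace ^ 2 ≠ 0 := pow_ne_zero 2 th0
    have hg' : g.1.trace ^ 2 = 1 ∨ g.1.trace ^ 2 = 2 := by
      rcases hg with hg | hg
      · left; rw [hg]; ring
      · right; exact hg
    have o : (1 : F) ≠ 0 := one_ne_zero
    rcases hg' with hg' | hg' <;> rw [hg'] at dc ⊢ <;> rcases e1 with e1 | e1 | e1
    · exact absurd e1 f1
    · exact e1
    · exfalso
      rw [e1] at dc
      rcases e2 with e2 | e2 | e2
      · exact f0 e2
      · rw [e2] at dc; apply o; linear_combination -dc
      · rw [e2] at dc; apply h4; linear_combination -dc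
    · exact absurd e1 f1
    · exfalso
      rw [e1] at dc
      rcases e2 with e2 | e2 | e2
      · exact f0 e2
      · rw [e2] at dc; apply o; linear_combination dc
      · rw [e2] at dc; apply o; linear_combination -dc
    · exact e1

end PSLSolv

open Matrix
set_option linter.unusedSimpArgs false
set_option linter.unusedVariables false
set_option linter.deprecated false

section PSLSolv
variable {F : Type*} [Field F]

local notation "M2" => Matrix (Fin 2) (Fin 2) F
local notation "SL" => Matrix.SpecialLinearGroup (Fin 2) F

theorem solv_iff_map {G : Type*} [Group G] (x y : G) :
    Group.IsSolvable (Subgroup.closure {x, y}) ↔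
      (QuotientGroup.mk y : G ⧸ Subgroup.center G) ∈
        solvabilizer (QuotientGroup.mk x : G ⧸ Subgroup.center G) := by
  have e : Subgroup.closure {(QuotientGroup.mk x : G ⧸ Subgroup.center G), QuotientGroup.mk y} =
      (Subgroup.closure {x, y}).map (QuotientGroup.mk' (Subgroup.center G)) := by
    rw [MonoidHom.map_closure, Set.image_pair]; rfl
  have e2 : (QuotientGroup.mk y : G ⧸ Subgroup.center G) ∈
        solvabilizer (QuotientGroup.mk x : G ⧸ Subgroup.center G) ↔
        Group.IsSolvable ((Subgroup.closure {x, y}).map (QuotientGroup.mk' (Subgroup.center G))) := by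
    rw [← e]; exact Iff.rfl
  rw [e2]
  constructor
  · intro h
    exact Group.isSolvable_of_surjective
      (f := (QuotientGroup.mk' (Subgroup.center G)).subgroupMap (Subgroup.closure {x, y}))
      (MonoidHom.subgroupMap_surjective _ _)
  · intro h
    let f := (QuotientGroup.mk' (Subgroup.center G)).subgroupMap (Subgroup.closure {x, y})
    have hk : Group.IsSolvable f.ker := by
      apply Group.isSolvable_of_comm
      rintro ⟨⟨a, ha⟩, ha'⟩ ⟨⟨b, hb⟩, hb'⟩
      apply Subtype.ext
      apply Subtype.ext
      change a * b = b * a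
      have h1 : (QuotientGroup.mk a : G ⧸ Subgroup.center G) = 1 := congrArg Subtype.val ha'
      have h2 := (QuotientGroup.eq_one_iff a).mp h1
      exact (Subgroup.mem_center_iff.mp h2 b).symm
    exact Group.isSolvable_of_ker_le_range f.ker.subtype f (by simp)

theorem Ssol_preimage (X : SL) : Ssol X =
    (QuotientGroup.mk : SL → SL ⧸ Subgroup.center SL) ⁻¹' solvabilizer (QuotientGroup.mk X) := by
  ext Y
  exact solv_iff_map X Y

theorem solvSet_ncard_eq : (solvSet (SL ⧸ Subgroup.center SL)).ncard = (Set.range (Ssol (F := F))).ncard := by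
  have hs : Function.Surjective (QuotientGroup.mk : SL → SL ⧸ Subgroup.center SL) :=
    QuotientGroup.mk_surjective
  have : Set.range (Ssol (F := F)) = Set.image (fun s => Set.preimage (QuotientGroup.mk : SL → SL ⧸ Subgroup.center SL) s)
      (solvSet (SL ⧸ Subgroup.center SL)) := by
    unfold solvSet
    rw [← Set.range_comp, ← hs.range_comp]
    congr 1
    ext1 X
    exact Ssol_preimage X
  rw [this, Set.ncard_image_of_injective _ hs.preimage_injective]

theorem Ssol_neg (X : SL) : Ssol (-X) = Ssol X := by
  rw [Ssol_preimage, Ssol_preimage]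
  congr 2
  rw [QuotientGroup.eq]
  have : (-X)⁻¹ * X = -1 := by rw [← neg_inv]; simp
  rw [this]
  apply sl_center_of_scalar _ (-1)
  simp

theorem Ssol_inv (X : SL) : Ssol X⁻¹ = Ssol X := by
  ext Y
  have : Subgroup.closure {X⁻¹, Y} = Subgroup.closure {X, Y} := by
    apply le_antisymm
    · exact closure_pair_le (Subgroup.inv_mem _ (mem_cl_left X Y)) (mem_cl_right X Y)
    · refine closure_pair_le ?_ (mem_cl_right _ Y)
      have := Subgroup.inv_mem _ (mem_cl_left X⁻¹ Y)
      simpa using this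
  unfold Ssol
  rw [Set.mem_setOf_eq, Set.mem_setOf_eq, this]

theorem sl_inv_eq (X : SL) : (X⁻¹ : SL).1 = X.1.trace • (1 : M2) - X.1 := by
  rw [Matrix.SpecialLinearGroup.coe_inv, Matrix.adjugate_fin_two]
  ext i j; fin_cases i <;> fin_cases j <;> simp [Matrix.trace_fin_two]

theorem vpart_ne_of_trace (X : SL) (h : X.1.trace ^ 2 ≠ 4) : vpart X.1 ≠ 0 := by
  intro h0
  have := vpart_det X.1 X.2
  rw [h0] at this
  apply h
  simp at this
  linear_combination this

theorem two_to_one (h2 : (2 : F) ≠ 0) (hF : HasGen F) (t : F) (ht : t ^ 2 ≠ 4) (X X' : SL)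
    (hX : X.1.trace = t) (hX' : X'.1.trace = t) : Ssol X' = Ssol X ↔ (X' = X ∨ X' = X⁻¹) := by
  constructor
  · intro h
    have hv := vpart_ne_of_trace X (by rw [hX]; exact ht)
    have hv' := vpart_ne_of_trace X' (by rw [hX']; exact ht)
    obtain ⟨c, hc, hcc⟩ := sameline h2 hF X X' hv hv' h.symm
    have dc := congrArg Matrix.det hcc
    rw [Matrix.det_smul, vpart_det _ X.2, vpart_det _ X'.2, hX, hX'] at dc
    have : (c - 1) * (c + 1) * (4 - t ^ 2) = 0 := by
      simp only [Fintype.card_fin] at dc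
      linear_combination -dc
    have h4 : 4 - t ^ 2 ≠ 0 := sub_ne_zero.mpr (Ne.symm ht)
    have e := eq_of_vpart h2 X.1
    have e' := eq_of_vpart h2 X'.1
    rcases mul_eq_zero.mp ((mul_eq_zero.mp this).resolve_right h4) with h | h
    · left
      have : c = 1 := by linear_combination h
      apply Subtype.ext
      rw [e, e', hcc, this, hX, hX', one_smul]
    · right
      have : c = -1 := by linear_combination h
      apply Subtype.ext
      rw [sl_inv_eq, e', hcc, this, hX, hX']
      rw [hX] at e
      conv_rhs => rw [e]
      have : t = t / 2 + t / 2 := by field_simp; ring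
      have q : t • (1 : M2) = (t / 2) • (1 : M2) + (t / 2) • (1 : M2) := by
        rw [← add_smul, ← this]
      rw [q]
      module
  · rintro (rfl | rfl)
    · rfl
    · exact Ssol_inv X

theorem ne_inv (h2 : (2 : F) ≠ 0) (X : SL) (h : X.1.trace ^ 2 ≠ 4) : X ≠ X⁻¹ := by
  intro h1
  apply vpart_ne_of_trace X h
  have h3 : X.1 = (X⁻¹ : SL).1 := congrArg Subtype.val h1
  rw [sl_inv_eq] at h3
  unfold vpart
  rw [two_smul]
  nth_rewrite 1 [h3]
  abel

theorem card_of_fibers {α β : Type*} [DecidableEq β] (s : Finset α) (f : α → β) (k : ℕ)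
    (h : ∀ a ∈ s, (s.filter (fun x => f x = f a)).card = k) : s.card = (s.image f).card * k := by
  rw [Finset.card_eq_sum_card_image f s, Finset.sum_const_nat]
  intro b hb
  obtain ⟨a, ha, rfl⟩ := Finset.mem_image.mp hb
  exact h a ha

open Classical in
theorem card_trace_image [Fintype F] (h2 : (2 : F) ≠ 0) (hF : HasGen F) (t : F) (ht : t ^ 2 ≠ 4) :
    (Finset.univ.filter (fun X : SL => X.1.trace = t)).card =
      ((Finset.univ.filter (fun X : SL => X.1.trace = t)).image Ssol).card * 2 := by
  apply card_of_fibers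
  intro X hX
  simp only [Finset.mem_filter, Finset.mem_univ, true_and] at hX
  have : (Finset.univ.filter (fun X : SL => X.1.trace = t)).filter (fun X' => Ssol X' = Ssol X) = {X, X⁻¹} := by
    ext X'
    simp only [Finset.mem_filter, Finset.mem_univ, true_and, Finset.mem_insert, Finset.mem_singleton]
    constructor
    · rintro ⟨h, h'⟩
      exact (two_to_one h2 hF t ht X X' hX h).mp h'
    · intro h
      have h' : X'.1.trace = t := by
        rcases h with rfl | rfl
        · exact hX
        · rw [sl_inv_eq, Matrix.trace_sub, Matrix.trace_smul, hX]
          simp; ring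
      exact ⟨h', (two_to_one h2 hF t ht X X' hX h').mpr h⟩
  rw [this, Finset.card_pair (ne_inv h2 X (by rw [hX]; exact ht))]

end PSLSolv

open Matrix
set_option linter.unusedSimpArgs false
set_option linter.unusedVariables false
set_option linter.deprecated false

section PSLSolv
variable {F : Type*} [Field F]

local notation "M2" => Matrix (Fin 2) (Fin 2) F
local notation "SL" => Matrix.SpecialLinearGroup (Fin 2) F

/-- traceless matrix with given coordinates -/
def mk3 (x : F × F × F) : M2 := !![x.1, x.2.1; x.2.2, -x.1]

theorem mk3_trace (x : F × F × F) : (mk3 x).trace = 0 := by simp [mk3, Matrix.trace_fin_two]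

theorem mk3_inj : Function.Injective (mk3 (F := F)) := by
  rintro ⟨a, b, c⟩ ⟨a', b', c'⟩ h
  have h1 := congrFun (congrFun h 0) 0
  have h2 := congrFun (congrFun h 0) 1
  have h3 := congrFun (congrFun h 1) 0
  simp [mk3] at h1 h2 h3
  simp [h1, h2, h3]

theorem mk3_smul (c : F) (x : F × F × F) : mk3 (c • x) = c • mk3 x := by
  ext i j; fin_cases i <;> fin_cases j <;> simp [mk3]

theorem mk3_zero : mk3 (0 : F × F × F) = 0 := by
  ext i j; fin_cases i <;> fin_cases j <;> simp [mk3]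

theorem mk3_surj (w : M2) (hw : w.trace = 0) : ∃ x, mk3 x = w := by
  refine ⟨(w 0 0, w 0 1, w 1 0), ?_⟩
  rw [Matrix.trace_fin_two] at hw
  have : w 1 1 = - w 0 0 := by linear_combination hw
  ext i j; fin_cases i <;> fin_cases j <;> simp [mk3, this]

open Classical in
theorem card_gen_image [Fintype F] (h2 : (2 : F) ≠ 0) (hF : HasGen F) :
    ((Finset.univ.filter (fun X : SL => IsGen X)).image Ssol).card =
      Fintype.card F ^ 2 + Fintype.card F + 1 := by
  have hex : ∀ x : F × F × F, ∃ U : SL, x ≠ 0 → (IsGen U ∧ ∃ c : F, c ≠ 0 ∧ vpart U.1 = c • mk3 x) := by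
    intro x
    by_cases hx : x = 0
    · exact ⟨1, fun h => absurd hx h⟩
    · obtain ⟨U, hU⟩ := exists_gen h2 hF (mk3 x) (by rw [← mk3_zero]; exact mk3_inj.ne hx) (mk3_trace x)
      exact ⟨U, fun _ => hU⟩
  choose U hU using hex
  let s : Finset (F × F × F) := Finset.univ.erase 0
  have hs : ∀ x, x ∈ s ↔ x ≠ 0 := by intro x; simp [s]
  have him : (Finset.univ.filter (fun X : SL => IsGen X)).image Ssol = s.image (fun x => Ssol (U x)) := by
    ext A
    simp only [Finset.mem_image, Finset.mem_filter, Finset.mem_univ, true_and]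
    constructor
    · rintro ⟨X, hX, rfl⟩
      obtain ⟨x, hx⟩ := mk3_surj (vpart X.1) (vpart_trace _)
      have hx0 : x ≠ 0 := by
        rintro rfl
        apply hX.1
        rw [← hx, mk3_zero]
      refine ⟨x, (hs x).mpr hx0, ?_⟩
      obtain ⟨h1, c, hc, h3⟩ := hU x hx0
      exact gen_eq h2 X (U x) hX h1 c (by rw [h3, hx])
    · rintro ⟨x, hx, rfl⟩
      exact ⟨U x, (hU x ((hs x).mp hx)).1, rfl⟩
  have hf := card_of_fibers s (fun x => Ssol (U x)) (Fintype.card F - 1) (by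
    intro x hx
    have hx0 := (hs x).mp hx
    obtain ⟨h1, c, hc, h3⟩ := hU x hx0
    have : s.filter (fun y => Ssol (U y) = Ssol (U x)) = (Finset.univ.erase (0 : F)).image (fun a => a • x) := by
      ext y
      simp only [Finset.mem_filter, Finset.mem_image, Finset.mem_erase, Finset.mem_univ, and_true, hs]
      constructor
      · rintro ⟨hy, hyx⟩
        obtain ⟨k1, d, hd, k3⟩ := hU y hy
        obtain ⟨e, he, he'⟩ := sameline h2 hF (U x) (U y) h1.1 k1.1 hyx.symm
        rw [k3, h3] at he'
        refine ⟨d⁻¹ * (e * c), by simp [hd, he, hc], ?_⟩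
        apply mk3_inj
        rw [mk3_smul, mul_smul, mul_smul, ← he', smul_smul, inv_mul_cancel₀ hd, one_smul]
      · rintro ⟨a, ha, rfl⟩
        have hy : a • x ≠ 0 := smul_ne_zero ha hx0
        refine ⟨hy, ?_⟩
        obtain ⟨k1, d, hd, k3⟩ := hU _ hy
        refine gen_eq h2 _ _ h1 k1 (d * a * c⁻¹) ?_
        rw [k3, h3, mk3_smul, smul_smul, smul_smul, mul_assoc, inv_mul_cancel₀ hc, mul_one]
    rw [this, Finset.card_image_of_injective _ (smul_left_injective F hx0)]
    simp [Finset.card_erase_of_mem])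
  rw [← him] at hf
  set N := ((Finset.univ.filter (fun X : SL => IsGen X)).image Ssol).card
  have hc : s.card = Fintype.card F ^ 3 - 1 := by
    simp [s, Finset.card_erase_of_mem]; ring_nf
  rw [hc] at hf
  have h1 : 1 < Fintype.card F := Fintype.one_lt_card
  obtain ⟨m, hm⟩ : ∃ m, Fintype.card F = m + 1 := ⟨Fintype.card F - 1, by omega⟩
  rw [hm] at hf ⊢
  have hm0 : 0 < m := by omega
  have e : (m + 1) ^ 3 - 1 = ((m + 1) ^ 2 + (m + 1) + 1) * m := by
    have : (m + 1) ^ 3 = ((m + 1) ^ 2 + (m + 1) + 1) * m + 1 := by ring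
    omega
  rw [e, Nat.add_sub_cancel] at hf
  exact (Nat.eq_of_mul_eq_mul_right hm0 hf).symm

set_option maxHeartbeats 1000000 in
open Classical in
theorem total_card [Fintype F] (h2 : (2 : F) ≠ 0) (h3 : (3 : F) ≠ 0) (hF : HasGen F) :
    ((∀ s : F, s ^ 2 = 2 → 2 * (Set.range (Ssol (F := F))).ncard =
      2 * (Fintype.card F ^ 2 + Fintype.card F + 2) +
      (Finset.univ.filter (fun X : SL => X.1.trace = 0)).card +
      (Finset.univ.filter (fun X : SL => X.1.trace = 1)).card +
      (Finset.univ.filter (fun X : SL => X.1.trace = s)).card)) ∧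
    ((∀ s : F, s ^ 2 ≠ 2) → 2 * (Set.range (Ssol (F := F))).ncard =
      2 * (Fintype.card F ^ 2 + Fintype.card F + 2) +
      (Finset.univ.filter (fun X : SL => X.1.trace = 0)).card +
      (Finset.univ.filter (fun X : SL => X.1.trace = 1)).card) := by
  have h4 : (4 : F) ≠ 0 := by
    have : (4 : F) = 2 * 2 := by norm_num
    rw [this]; exact mul_ne_zero h2 h2
  have n0 : (0 : F) ^ 2 ≠ 4 := by
    intro h; apply h4; rw [← h]; ring
  have n1 : (1 : F) ^ 2 ≠ 4 := by
    intro h; apply h3; linear_combination -h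
  have c0 := card_trace_image h2 hF 0 n0
  have c1 := card_trace_image h2 hF 1 n1
  have cg := card_gen_image h2 hF
  let I : F → Finset (Set SL) := fun t => (Finset.univ.filter (fun X : SL => X.1.trace = t)).image Ssol
  let Gn : Finset (Set SL) := (Finset.univ.filter (fun X : SL => IsGen X)).image Ssol
  have hI : ∀ t A, A ∈ I t ↔ ∃ X : SL, X.1.trace = t ∧ Ssol X = A := by intro t A; simp [I]
  have hG : ∀ A, A ∈ Gn ↔ ∃ X : SL, IsGen X ∧ Ssol X = A := by intro A; simp [Gn]
  have c0 : _ = (I 0).card * 2 := c0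
  have c1 : _ = (I 1).card * 2 := c1
  have ct : ∀ t : F, t ^ 2 ≠ 4 → (Finset.univ.filter (fun X : SL => X.1.trace = t)).card = (I t).card * 2 :=
    fun t ht => card_trace_image h2 hF t ht
  have cg : Gn.card = _ := cg
  clear_value I Gn
  have hr : Set.range (Ssol (F := F)) = ((Finset.univ.image (Ssol (F := F)) : Finset (Set SL)) : Set (Set SL)) := by
    simp
  rw [hr, Set.ncard_coe_finset]
  have ne_of : ∀ t : F, t ^ 2 ≠ 4 → ∀ X : SL, X.1.trace = t → vpart X.1 ≠ 0 := fun t ht X hX =>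
    vpart_ne_of_trace X (by rw [hX]; exact ht)
  have d1 : Disjoint ({Set.univ} : Finset (Set SL)) Gn := by
    rw [Finset.disjoint_singleton_left, hG]
    rintro ⟨X, hX, h⟩
    exact Ssol_ne_univ h2 hF X hX.1 h
  have d2 : ∀ t : F, t ^ 2 ≠ 4 → Disjoint ({Set.univ} : Finset (Set SL)) (I t) := by
    intro t ht
    rw [Finset.disjoint_singleton_left, hI]
    rintro ⟨X, hX, h⟩
    exact Ssol_ne_univ h2 hF X (ne_of t ht X hX) h
  have d3 : Disjoint Gn (I 0) := by
    rw [Finset.disjoint_left]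
    intro A hA hB
    obtain ⟨X, hX, rfl⟩ := (hG A).mp hA
    obtain ⟨Y, hY, h⟩ := (hI 0 _).mp hB
    exact hX.2.1 ((trzero_iff h2 hF Y X (ne_of 0 n0 Y hY) hX.1 h).mp hY)
  have d4 : ∀ t : F, t ^ 2 ≠ 4 → t ≠ 0 → Disjoint (I 0) (I t) := by
    intro t ht t0
    rw [Finset.disjoint_left]
    intro A hA hB
    obtain ⟨X, hX, rfl⟩ := (hI 0 _).mp hA
    obtain ⟨Y, hY, h⟩ := (hI t _).mp hB
    have := (trzero_iff h2 hF X Y (ne_of 0 n0 X hX) (ne_of t ht Y hY) h.symm).mp hX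
    exact t0 (hY.symm.trans this)
  have d5 : Disjoint Gn (I 1) := by
    rw [Finset.disjoint_left]
    intro A hA hB
    obtain ⟨X, hX, rfl⟩ := (hG A).mp hA
    obtain ⟨Y, hY, h⟩ := (hI 1 _).mp hB
    have := kind_aux h2 h3 hF Y X (Or.inl hY) hX.1 h
    rw [hY] at this
    exact hX.2.2.1 (by rw [this]; ring)
  have d6 : ∀ s : F, s ^ 2 = 2 → Disjoint Gn (I s) := by
    intro s hs
    rw [Finset.disjoint_left]
    intro A hA hB
    obtain ⟨X, hX, rfl⟩ := (hG A).mp hA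
    obtain ⟨Y, hY, h⟩ := (hI s _).mp hB
    have := kind_aux h2 h3 hF Y X (Or.inr (by rw [hY]; exact hs)) hX.1 h
    rw [hY] at this
    exact hX.2.2.2 (by rw [this, hs])
  have d7 : ∀ s : F, s ^ 2 = 2 → s ^ 2 ≠ 4 → Disjoint (I 1) (I s) := by
    intro s hs hs4
    rw [Finset.disjoint_left]
    intro A hA hB
    obtain ⟨X, hX, rfl⟩ := (hI 1 _).mp hA
    obtain ⟨Y, hY, h⟩ := (hI s _).mp hB
    have := kind_aux h2 h3 hF X Y (Or.inl hX) (ne_of s hs4 Y hY) h.symm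
    rw [hY, hX, hs] at this
    apply one_ne_zero (α := F); linear_combination this
  have hmem : ∀ X : SL, Ssol X = Set.univ ∨ IsGen X ∨ X.1.trace = 0 ∨ X.1.trace ^ 2 = 1 ∨ X.1.trace ^ 2 = 2 := by
    intro X
    by_cases hv : vpart X.1 = 0
    · exact Or.inl (Ssol_central h2 X hv)
    · unfold IsGen
      tauto
  have hsq : ∀ (X : SL) (s : F), X.1.trace ^ 2 = s ^ 2 → Ssol X ∈ I s := by
    intro X s h
    rw [hI]
    rcases sq_eq_sq_iff_eq_or_eq_neg.mp h with h | h
    · exact ⟨X, h, rfl⟩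
    · refine ⟨-X, ?_, Ssol_neg X⟩
      rw [Matrix.SpecialLinearGroup.coe_neg, Matrix.trace_neg, h, neg_neg]
  have huniv : Ssol (1 : SL) = Set.univ := Ssol_central h2 1 (by
    ext i j; fin_cases i <;> fin_cases j <;> simp [vpart])
  have hall : ∀ X : SL, Ssol X ∈ Finset.univ.image (Ssol (F := F)) := by intro X; simp
  constructor
  · intro s hs
    have hs4 : s ^ 2 ≠ 4 := by
      rw [hs]; intro h; apply h2; linear_combination -h
    have hs0 : s ≠ 0 := by
      rintro rfl
      apply h2; rw [← hs]; ring
    have cs := ct s hs4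
    have e : Finset.univ.image (Ssol (F := F)) = {Set.univ} ∪ Gn ∪ I 0 ∪ I 1 ∪ I s := by
      ext A
      simp only [Finset.mem_union, Finset.mem_singleton]
      constructor
      · intro hA
        obtain ⟨X, -, rfl⟩ := Finset.mem_image.mp hA
        rcases hmem X with h | h | h | h | h
        · simp [h]
        · have := (hG _).mpr ⟨X, h, rfl⟩
          exact Or.inl (Or.inl (Or.inl (Or.inr this)))
        · have := (hI _ _).mpr ⟨X, h, rfl⟩
          exact Or.inl (Or.inl (Or.inr this))
        · have := hsq X 1 (by rw [h]; ring)
          exact Or.inl (Or.inr this)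
        · have := hsq X s (by rw [h, hs])
          exact Or.inr this
      · rintro ((((h | h) | h) | h) | h)
        · rw [h, ← huniv]; exact hall 1
        · obtain ⟨X, -, rfl⟩ := (hG A).mp h; exact hall X
        · obtain ⟨X, -, rfl⟩ := (hI _ A).mp h; exact hall X
        · obtain ⟨X, -, rfl⟩ := (hI _ A).mp h; exact hall X
        · obtain ⟨X, -, rfl⟩ := (hI _ A).mp h; exact hall X
    rw [e, Finset.card_union_of_disjoint, Finset.card_union_of_disjoint,
      Finset.card_union_of_disjoint, Finset.card_union_of_disjoint d1]
    · rw [c0, c1, cs, cg, Finset.card_singleton]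
      ring
    · rw [Finset.disjoint_union_left]; exact ⟨d2 0 n0, d3⟩
    · rw [Finset.disjoint_union_left, Finset.disjoint_union_left]
      exact ⟨⟨d2 1 n1, d5⟩, d4 1 n1 one_ne_zero⟩
    · rw [Finset.disjoint_union_left, Finset.disjoint_union_left, Finset.disjoint_union_left]
      exact ⟨⟨⟨d2 s hs4, d6 s hs⟩, d4 s hs4 hs0⟩, d7 s hs hs4⟩
  · intro hs
    have e : Finset.univ.image (Ssol (F := F)) = {Set.univ} ∪ Gn ∪ I 0 ∪ I 1 := by
      ext A
      simp only [Finset.mem_union, Finset.mem_singleton]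
      constructor
      · intro hA
        obtain ⟨X, -, rfl⟩ := Finset.mem_image.mp hA
        rcases hmem X with h | h | h | h | h
        · simp [h]
        · have := (hG _).mpr ⟨X, h, rfl⟩
          exact Or.inl (Or.inl (Or.inr this))
        · have := (hI _ _).mpr ⟨X, h, rfl⟩
          exact Or.inl (Or.inr this)
        · have := hsq X 1 (by rw [h]; ring)
          exact Or.inr this
        · exact absurd h (hs _)
      · rintro (((h | h) | h) | h)
        · rw [h, ← huniv]; exact hall 1
        · obtain ⟨X, -, rfl⟩ := (hG A).mp h; exact hall X
        · obtain ⟨X, -, rfl⟩ := (hI _ A).mp h; exact hall X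
        · obtain ⟨X, -, rfl⟩ := (hI _ A).mp h; exact hall X
    rw [e, Finset.card_union_of_disjoint, Finset.card_union_of_disjoint,
      Finset.card_union_of_disjoint d1]
    · rw [c0, c1, cg, Finset.card_singleton]
      ring
    · rw [Finset.disjoint_union_left]; exact ⟨d2 0 n0, d3⟩
    · rw [Finset.disjoint_union_left, Finset.disjoint_union_left]
      exact ⟨⟨d2 1 n1, d5⟩, d4 1 n1 one_ne_zero⟩

end PSLSolv

open Matrix
set_option linter.unusedSimpArgs false
set_option linter.unusedVariables false
set_option linter.deprecated false

section PSLSolv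
variable {F : Type*} [Field F]

local notation "M2" => Matrix (Fin 2) (Fin 2) F
local notation "SL" => Matrix.SpecialLinearGroup (Fin 2) F

open Classical in
theorem card_mul_eq [Fintype F] (k : F) :
    (Finset.univ.filter (fun x : F × F => x.1 * x.2 = k)).card =
      (Fintype.card F - 1) + if k = 0 then Fintype.card F else 0 := by
  rw [Finset.card_filter, Fintype.sum_prod_type, ← Finset.sum_erase_add _ _ (Finset.mem_univ (0 : F))]
  congr 1
  · rw [Finset.sum_congr rfl (g := fun _ => 1)]
    · simp [Finset.card_erase_of_mem]
    · intro b hb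
      have hb0 : b ≠ 0 := (Finset.mem_erase.mp hb).1
      rw [← Finset.card_filter, Finset.card_eq_one]
      refine ⟨k / b, ?_⟩
      ext c
      simp only [Finset.mem_filter, Finset.mem_univ, true_and, Finset.mem_singleton]
      rw [eq_div_iff hb0, mul_comm]
  · simp only [zero_mul]
    by_cases hk : k = 0
    · simp [hk]
    · simp [hk, Ne.symm hk]

open Classical in
theorem card_T [Fintype F] (t : F) :
    (Finset.univ.filter (fun X : SL => X.1.trace = t)).card =
      Fintype.card F * (Fintype.card F - 1) +
      Fintype.card F * (Finset.univ.filter (fun a : F => a * (t - a) - 1 = 0)).card := by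
  have e : (Finset.univ.filter (fun X : SL => X.1.trace = t)).card =
      (Finset.univ.filter (fun x : F × (F × F) => x.2.1 * x.2.2 = x.1 * (t - x.1) - 1)).card := by
    refine Finset.card_bij (fun X _ => (X.1 0 0, X.1 0 1, X.1 1 0)) ?_ ?_ ?_
    · intro X hX
      simp only [Finset.mem_filter, Finset.mem_univ, true_and, Matrix.trace_fin_two] at hX ⊢
      have := X.2
      rw [Matrix.det_fin_two] at this
      rw [← hX]
      linear_combination -this
    · intro X hX Y hY h
      simp only [Finset.mem_filter, Finset.mem_univ, true_and, Matrix.trace_fin_two] at hX hY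
      simp only [Prod.mk.injEq] at h
      apply Subtype.ext
      obtain ⟨h1, h2, h3⟩ := h
      have h4 : X.1 1 1 = Y.1 1 1 := by linear_combination hX - hY - h1
      ext i j; fin_cases i <;> fin_cases j
      · exact h1
      · exact h2
      · exact h3
      · exact h4
    · rintro ⟨a, b, c⟩ h
      simp only [Finset.mem_filter, Finset.mem_univ, true_and] at h
      refine ⟨⟨!![a, b; c, t - a], ?_⟩, ?_, ?_⟩
      · rw [Matrix.det_fin_two]; simp; linear_combination -h
      · apply Finset.mem_filter.mpr
        exact ⟨Finset.mem_univ _, by rw [Matrix.trace_fin_two]; simp⟩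
      · simp
  rw [e, Finset.card_filter, Fintype.sum_prod_type]
  have : ∀ a : F, (∑ y : F × F, if y.1 * y.2 = a * (t - a) - 1 then 1 else 0) =
      (Fintype.card F - 1) + if a * (t - a) - 1 = 0 then Fintype.card F else 0 := by
    intro a
    rw [← Finset.card_filter, card_mul_eq]
  simp only [this]
  rw [Finset.sum_add_distrib, Finset.sum_const, Finset.card_univ, smul_eq_mul, ← Finset.sum_filter,
    Finset.sum_const, smul_eq_mul, mul_comm (Finset.card _)]

open Classical in
theorem card_T_sq [Fintype F] (h2 : (2 : F) ≠ 0) (t r : F) (hr : r ^ 2 = t ^ 2 - 4) (hr0 : r ≠ 0) :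
    (Finset.univ.filter (fun X : SL => X.1.trace = t)).card =
      Fintype.card F * (Fintype.card F - 1) + Fintype.card F * 2 := by
  rw [card_T]
  congr 2
  rw [Finset.card_eq_two]
  refine ⟨(t + r) / 2, (t - r) / 2, ?_, ?_⟩
  · intro h
    field_simp at h
    apply mul_ne_zero h2 hr0
    linear_combination h
  · ext a
    simp only [Finset.mem_filter, Finset.mem_univ, true_and, Finset.mem_insert, Finset.mem_singleton]
    rw [eq_div_iff h2, eq_div_iff h2]
    constructor
    · intro h
      have : (a * 2 - (t + r)) * (a * 2 - (t - r)) = 0 := by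
        linear_combination -4 * h - hr
      rcases mul_eq_zero.mp this with h | h
      · left; linear_combination h
      · right; linear_combination h
    · intro h
      have h4 : (4 : F) ≠ 0 := by
        have : (4 : F) = 2 * 2 := by norm_num
        rw [this]; exact mul_ne_zero h2 h2
      have : (a * 2 - (t + r)) * (a * 2 - (t - r)) = 0 := by
        rcases h with h | h <;> rw [h] <;> ring
      have : 4 * (a * (t - a) - 1) = 0 := by linear_combination -this - hr
      exact (mul_eq_zero.mp this).resolve_left h4

open Classical in
theorem card_T_nsq [Fintype F] (t : F) (hr : ∀ r : F, r ^ 2 ≠ t ^ 2 - 4) :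
    (Finset.univ.filter (fun X : SL => X.1.trace = t)).card =
      Fintype.card F * (Fintype.card F - 1) := by
  rw [card_T, Finset.filter_eq_empty_iff.mpr]
  · simp
  · intro a _ h
    apply hr (2 * a - t)
    linear_combination -4 * h

end PSLSolv

theorem hasGen_aux11 : ∀ d : ZMod 11, ∃ s c : ZMod 11, s ^ 2 + d * c ^ 2 = 1 ∧ c ≠ 0 ∧ s ≠ 0 ∧
    (2 * s) ^ 2 ≠ 1 ∧ (2 * s) ^ 2 ≠ 2 := by
  decide +kernel

theorem hasGen_aux13 : ∀ d : ZMod 13, ∃ s c : ZMod 13, s ^ 2 + d * c ^ 2 = 1 ∧ c ≠ 0 ∧ s ≠ 0 ∧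
    (2 * s) ^ 2 ≠ 1 ∧ (2 * s) ^ 2 ≠ 2 := by
  decide +kernel

section ZModPart
variable (p : ℕ) [hp : Fact p.Prime]

theorem zmod_nat_ne (n : ℕ) (hn : 0 < n) (h : n < p) : (n : ZMod p) ≠ 0 := by
  intro e
  rw [ZMod.natCast_eq_zero_iff] at e
  exact absurd (Nat.le_of_dvd hn e) (by omega)

theorem hasGen_zmod (h7 : 7 < p) : HasGen (ZMod p) := by
  have hp' := hp.out
  by_cases h11 : p = 11
  · subst h11; exact hasGen_aux11
  by_cases h13 : p = 13
  · subst h13; exact hasGen_aux13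
  have h17 : 13 < p := by
    by_contra h
    have : p = 8 ∨ p = 9 ∨ p = 10 ∨ p = 12 := by omega
    rcases this with rfl | rfl | rfl | rfl <;> revert hp' <;> norm_num
  have h2 : (2 : ZMod p) ≠ 0 := by exact_mod_cast zmod_nat_ne p 2 (by norm_num) (by omega)
  have h3 : (3 : ZMod p) ≠ 0 := by exact_mod_cast zmod_nat_ne p 3 (by norm_num) (by omega)
  intro d
  open Polynomial in
  let f : (ZMod p)[X] := X * (C d * X ^ 2 + 1) * (C d * X ^ 2 - 1) * (C (3 * d) * X ^ 2 - 1) *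
    (C d * X ^ 2 - 3) * (C (d ^ 2) * X ^ 4 - C (6 * d) * X ^ 2 + 1)
  have hnz : ∀ g : Polynomial (ZMod p), g.eval 0 ≠ 0 → g ≠ 0 := by
    rintro g hg rfl; simp at hg
  have hf : f ≠ 0 := by
    refine mul_ne_zero (mul_ne_zero (mul_ne_zero (mul_ne_zero (mul_ne_zero Polynomial.X_ne_zero ?_) ?_) ?_) ?_) ?_
    all_goals apply hnz; simp [h3]
  have hdeg : f.natDegree ≤ 13 := by
    simp only [f]; compute_degree
  obtain ⟨m, hm⟩ := Polynomial.exists_eval_ne_zero_of_natDegree_lt_card f hf (by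
    rw [Cardinal.mk_fintype, ZMod.card]
    exact_mod_cast lt_of_le_of_lt hdeg h17)
  simp only [f, Polynomial.eval_mul, Polynomial.eval_add, Polynomial.eval_sub, Polynomial.eval_pow,
    Polynomial.eval_X, Polynomial.eval_C, Polynomial.eval_one, mul_ne_zero_iff, Polynomial.eval_ofNat] at hm
  obtain ⟨⟨⟨⟨⟨m0, m1⟩, m2⟩, m3⟩, m4⟩, m5⟩ := hm
  have m1' : 1 + d * m ^ 2 ≠ 0 := by rwa [add_comm]
  refine ⟨(1 - d * m ^ 2) / (1 + d * m ^ 2), 2 * m / (1 + d * m ^ 2), ?_, ?_, ?_, ?_, ?_⟩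
  · field_simp; ring
  · exact div_ne_zero (mul_ne_zero h2 m0) m1'
  · refine div_ne_zero ?_ m1'
    intro h; apply m2; linear_combination -h
  · intro h
    field_simp at h
    have : (3 * d * m ^ 2 - 1) * (d * m ^ 2 - 3) = 0 := by linear_combination h
    rcases mul_eq_zero.mp this with h | h
    · exact m3 h
    · exact m4 h
  · intro h
    field_simp at h
    apply m5
    linear_combination h

theorem neg_three_sq (h7 : 7 < p) : (∃ r : ZMod p, r ^ 2 = -3) ↔ p % 3 = 1 := by
  have h2 : (2 : ZMod p) ≠ 0 := by exact_mod_cast zmod_nat_ne p 2 (by norm_num) (by omega)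
  have h3 : (3 : ZMod p) ≠ 0 := by exact_mod_cast zmod_nat_ne p 3 (by norm_num) (by omega)
  have : Fact (Nat.Prime 3) := ⟨Nat.prime_three⟩
  constructor
  · rintro ⟨r, hr⟩
    have e3 : ((r - 1) / 2) ^ 3 = 1 := by
      field_simp
      linear_combination (r - 3) * hr
    have e1 : (r - 1) / 2 ≠ 1 := by
      intro h
      field_simp at h
      have : r = 3 := by linear_combination h
      rw [this] at hr
      have h12 : (3 : ZMod p) * (2 * 2) = 0 := by linear_combination hr
      simp [h2, h3] at h12
    have ho := orderOf_eq_prime e3 e1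
    have h0 : (r - 1) / 2 ≠ 0 := by
      intro h; rw [h] at e3; simp at e3
    have := orderOf_dvd_of_pow_eq_one (ZMod.pow_card_sub_one_eq_one h0)
    rw [ho] at this
    omega
  · intro h
    have hc : 3 ∣ Fintype.card (ZMod p)ˣ := by
      rw [ZMod.card_units]; omega
    obtain ⟨x, hx⟩ := exists_prime_orderOf_dvd_card 3 hc
    have hx3 : (x : ZMod p) ^ 3 = 1 := by
      have := pow_orderOf_eq_one x
      rw [hx] at this
      rw [← Units.val_pow_eq_pow_val, this, Units.val_one]
    have hx1 : (x : ZMod p) - 1 ≠ 0 := by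
      intro h
      have : x = 1 := Units.ext (by simpa using sub_eq_zero.mp h)
      rw [this] at hx; simp at hx
    have : ((x : ZMod p) - 1) * ((x : ZMod p) ^ 2 + x + 1) = 0 := by linear_combination hx3
    have := (mul_eq_zero.mp this).resolve_left hx1
    exact ⟨2 * x + 1, by linear_combination 4 * this⟩

end ZModPart


theorem final_aux (p : ℕ) (hp : p.Prime) (hp7 : 7 < p) :
    ((p % 8 = 1 ∨ p % 8 = 7) → 2 * (solvSet (PSL 2 (ZMod p))).ncard = 2 * (p ^ 2 + p + 2) +
      (p * (p - 1) + if p % 4 = 3 then 0 else p * 2) +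
      (p * (p - 1) + if p % 3 = 1 then p * 2 else 0) +
      (p * (p - 1) + if p % 4 = 3 then 0 else p * 2)) ∧
    (¬ (p % 8 = 1 ∨ p % 8 = 7) → 2 * (solvSet (PSL 2 (ZMod p))).ncard = 2 * (p ^ 2 + p + 2) +
      (p * (p - 1) + if p % 4 = 3 then 0 else p * 2) +
      (p * (p - 1) + if p % 3 = 1 then p * 2 else 0)) := by
  classical
  have : Fact p.Prime := ⟨hp⟩
  have h2 : (2 : ZMod p) ≠ 0 := by exact_mod_cast zmod_nat_ne p 2 (by norm_num) (by omega)
  have h3 : (3 : ZMod p) ≠ 0 := by exact_mod_cast zmod_nat_ne p 3 (by norm_num) (by omega)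
  have h4 : (4 : ZMod p) ≠ 0 := by exact_mod_cast zmod_nat_ne p 4 (by norm_num) (by omega)
  obtain ⟨A, B⟩ := total_card h2 h3 (hasGen_zmod p hp7)
  have hN : (solvSet (PSL 2 (ZMod p))).ncard = (Set.range (Ssol (F := ZMod p))).ncard :=
    solvSet_ncard_eq
  rw [← hN, ZMod.card] at A B
  have key : ∀ t : ZMod p, t ^ 2 - 4 ≠ 0 → (Finset.univ.filter
      (fun X : Matrix.SpecialLinearGroup (Fin 2) (ZMod p) => X.1.trace = t)).card =
      p * (p - 1) + if ∃ r : ZMod p, r ^ 2 = t ^ 2 - 4 then p * 2 else 0 := by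
    intro t ht
    split_ifs with h
    · obtain ⟨r, hr⟩ := h
      have := card_T_sq h2 t r hr (by rintro rfl; apply ht; rw [← hr]; ring)
      rw [ZMod.card] at this
      convert this
    · push Not at h
      have := card_T_nsq t h
      rw [ZMod.card] at this
      rw [add_zero]
      convert this
  have hm : IsSquare (-1 : ZMod p) ↔ p % 4 ≠ 3 := ZMod.exists_sq_eq_neg_one_iff
  have h22 : IsSquare (2 : ZMod p) ↔ p % 8 = 1 ∨ p % 8 = 7 :=
    ZMod.exists_sq_eq_two_iff (by omega)
  have T0 : (Finset.univ.filter
      (fun X : Matrix.SpecialLinearGroup (Fin 2) (ZMod p) => X.1.trace = 0)).card =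
      p * (p - 1) + if p % 4 = 3 then 0 else p * 2 := by
    rw [key 0 (by intro h; apply h4; linear_combination -h)]
    have e : (∃ r : ZMod p, r ^ 2 = 0 ^ 2 - 4) ↔ ¬ p % 4 = 3 := by
      rw [← ne_eq, ← hm]
      constructor
      · rintro ⟨r, hr⟩
        refine ⟨r / 2, ?_⟩
        field_simp
        linear_combination -hr
      · rintro ⟨i, hi⟩
        exact ⟨2 * i, by linear_combination -4 * hi⟩
    simp only [e, ite_not]
  have T1 : (Finset.univ.filter
      (fun X : Matrix.SpecialLinearGroup (Fin 2) (ZMod p) => X.1.trace = 1)).card =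
      p * (p - 1) + if p % 3 = 1 then p * 2 else 0 := by
    rw [key 1 (by intro h; apply h3; linear_combination -h)]
    have e : (∃ r : ZMod p, r ^ 2 = 1 ^ 2 - 4) ↔ p % 3 = 1 := by
      rw [← neg_three_sq p hp7]
      have : (1 : ZMod p) ^ 2 - 4 = -3 := by ring
      rw [this]
    simp only [e]
  have Ts : ∀ s : ZMod p, s ^ 2 = 2 → (Finset.univ.filter
      (fun X : Matrix.SpecialLinearGroup (Fin 2) (ZMod p) => X.1.trace = s)).card =
      p * (p - 1) + if p % 4 = 3 then 0 else p * 2 := by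
    intro s hs
    have hs0 : s ≠ 0 := by rintro rfl; apply h2; rw [← hs]; ring
    rw [key s (by intro h; apply h2; linear_combination hs - h)]
    have e : (∃ r : ZMod p, r ^ 2 = s ^ 2 - 4) ↔ ¬ p % 4 = 3 := by
      rw [← ne_eq, ← hm]
      constructor
      · rintro ⟨r, hr⟩
        refine ⟨r / s, ?_⟩
        field_simp
        linear_combination -hr - 2 * hs
      · rintro ⟨i, hi⟩
        exact ⟨s * i, by linear_combination -s ^ 2 * hi - 2 * hs⟩
    simp only [e, ite_not]
  constructor
  · intro h8
    obtain ⟨s, hs⟩ := h22.mpr h8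
    have hs2 : s ^ 2 = 2 := by rw [hs]; ring
    have := A s hs2
    have q := Ts s hs2
    rw [← q]
    rw [← T1]
    nth_rewrite 1 [q]
    rw [← T0]
    convert this
  · intro h8
    have := B (by intro s hs; exact h8 (h22.mp ⟨s, by rw [← hs]; ring⟩))
    rw [← T0, ← T1]
    convert this

theorem solvSet_ncard_PSL_two_p (p : ℕ) (hp : p.Prime) (hp7 : 7 < p) :
    (p % 24 = 1 → 2 * (solvSet (PSL 2 (ZMod p))).ncard = 5 * p ^ 2 + 5 * p + 4) ∧
    (p % 24 = 5 → (solvSet (PSL 2 (ZMod p))).ncard = 2 * p ^ 2 + p + 2) ∧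
    (p % 24 = 7 → 2 * (solvSet (PSL 2 (ZMod p))).ncard = 5 * p ^ 2 + p + 4) ∧
    (p % 24 = 11 → (solvSet (PSL 2 (ZMod p))).ncard = 2 * p ^ 2 + 2) ∧
    (p % 24 = 13 → (solvSet (PSL 2 (ZMod p))).ncard = 2 * p ^ 2 + 2 * p + 2) ∧
    (p % 24 = 17 → 2 * (solvSet (PSL 2 (ZMod p))).ncard = 5 * p ^ 2 + 3 * p + 4) ∧
    (p % 24 = 19 → (solvSet (PSL 2 (ZMod p))).ncard = 2 * p ^ 2 + p + 2) ∧
    (p % 24 = 23 → 2 * (solvSet (PSL 2 (ZMod p))).ncard = 5 * p ^ 2 - p + 4) := by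
  obtain ⟨A, B⟩ := final_aux p hp hp7
  have e : p * (p - 1) + p = p ^ 2 := by
    obtain ⟨m, rfl⟩ : ∃ m, p = m + 1 := ⟨p - 1, by omega⟩
    simp only [Nat.add_sub_cancel]; ring
  generalize p * (p - 1) = u at *
  generalize p ^ 2 = v at *
  generalize (solvSet (PSL 2 (ZMod p))).ncard = N at *
  refine ⟨?_, ?_, ?_, ?_, ?_, ?_, ?_, ?_⟩ <;> intro h
  · have := A (by omega)
    rw [if_neg (by omega), if_pos (by omega)] at this; omega
  · have := B (by omega)
    rw [if_neg (by omega), if_neg (by omega)] at this; omega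
  · have := A (by omega)
    rw [if_pos (by omega), if_pos (by omega)] at this; omega
  · have := B (by omega)
    rw [if_pos (by omega), if_neg (by omega)] at this; omega
  · have := B (by omega)
    rw [if_neg (by omega), if_pos (by omega)] at this; omega
  · have := A (by omega)
    rw [if_neg (by omega), if_neg (by omega)] at this; omega
  · have := B (by omega)
    rw [if_pos (by omega), if_pos (by omega)] at this; omega
  · have := A (by omega)
    rw [if_pos (by omega), if_neg (by omega)] at this; omega
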